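/- Let n ≥ 1, let U ⊂ ℝ^{2n} be a nonempty open, bounded, connected set, let s : U → ℝ^{2n} be a bounded measurable measure preserving map, and let 1 ≤ p < ∞. Then for every ε > 0 there exists a C^∞ diffeomorphism S : ℝ^{2n} → ℝ^{2n} which is symplectic, i.e. DS(x)ᵀ J DS(x) = J for all x ∈ ℝ^{2n}, such that ∫_U |s(x) − S(x)|^p dx ≤ ε. -/

import Mathlib

open MeasureTheory Metric Set Bornology Matrix

noncomputable section

/-- The matrix of the derivative `Du(x)` in the standard basis of `ℝ^{2n}`
(junk value if `u` is not differentiable at `x`). -/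
def matD {n : ℕ} (u : EuclideanSpace ℝ (Fin n ⊕ Fin n) → EuclideanSpace ℝ (Fin n ⊕ Fin n))
    (x : EuclideanSpace ℝ (Fin n ⊕ Fin n)) : Matrix (Fin n ⊕ Fin n) (Fin n ⊕ Fin n) ℝ :=
  LinearMap.toMatrix (EuclideanSpace.basisFun (Fin n ⊕ Fin n) ℝ).toBasis
    (EuclideanSpace.basisFun (Fin n ⊕ Fin n) ℝ).toBasis ((fderiv ℝ u x).toLinearMap)

set_option linter.unusedSimpArgs false

section Abstract
open scoped RealInnerProductSpace
variable {V : Type*} [NormedAddCommGroup V] [InnerProductSpace ℝ V]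

/-- projection onto the orthogonal complement of the plane spanned by orthonormal `a`, `b` -/
def prP (a b : V) : V →L[ℝ] V :=
  ContinuousLinearMap.id ℝ V - (innerSL ℝ a).smulRight a - (innerSL ℝ b).smulRight b

lemma prP_apply (a b u : V) : prP a b u = u - ⟪a, u⟫ • a - ⟪b, u⟫ • b := by
  simp [prP]

/-- the explicit localized shear -/
def twist (J : V →L[ℝ] V) (a b c : V) (κ : ℝ) (F f ψ ψ₁ : ℝ → ℝ) (x : V) : V :=
  x + (f ⟪b, x⟫ * ψ (‖prP a b x - c‖ ^ 2)) • a
    + (Real.cos (-2 * κ * (F ⟪b, x⟫ * ψ₁ (‖prP a b x - c‖ ^ 2))) - 1) • (prP a b x - c)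
    + Real.sin (-2 * κ * (F ⟪b, x⟫ * ψ₁ (‖prP a b x - c‖ ^ 2))) • J (prP a b x - c)

lemma twist_contDiff (J : V →L[ℝ] V) (a b c : V) (κ : ℝ) (F f ψ ψ₁ : ℝ → ℝ)
    (hF : ContDiff ℝ (⊤ : ℕ∞) F) (hf : ContDiff ℝ (⊤ : ℕ∞) f)
    (hψ : ContDiff ℝ (⊤ : ℕ∞) ψ) (hψ₁ : ContDiff ℝ (⊤ : ℕ∞) ψ₁) :
    ContDiff ℝ (⊤ : ℕ∞) (twist J a b c κ F f ψ ψ₁) := by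
  have ht : ContDiff ℝ (⊤ : ℕ∞) (fun x : V => ⟪b, x⟫) := contDiff_const.inner ℝ contDiff_id
  have hv : ContDiff ℝ (⊤ : ℕ∞) (fun x : V => prP a b x - c) :=
    (prP a b).contDiff.sub contDiff_const
  have hJv : ContDiff ℝ (⊤ : ℕ∞) (fun x : V => J (prP a b x - c)) := J.contDiff.comp hv
  have hr : ContDiff ℝ (⊤ : ℕ∞) (fun x : V => ‖prP a b x - c‖ ^ 2) := hv.norm_sq ℝ
  have hth : ContDiff ℝ (⊤ : ℕ∞)
      (fun x : V => -2 * κ * (F ⟪b, x⟫ * ψ₁ (‖prP a b x - c‖ ^ 2))) :=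
    contDiff_const.mul ((hF.comp ht).mul (hψ₁.comp hr))
  exact ((contDiff_id.add (((hf.comp ht).mul (hψ.comp hr)).smul contDiff_const)).add
    (((Real.contDiff_cos.comp hth).sub contDiff_const).smul hv)).add
    ((Real.contDiff_sin.comp hth).smul hJv)

lemma twist_hasFDerivAt (J : V →L[ℝ] V) (a b c : V) (κ : ℝ) (F f f₁ ψ ψ₁ ψ₂ : ℝ → ℝ)
    (hF : ∀ t, HasDerivAt F (f t) t) (hf : ∀ t, HasDerivAt f (f₁ t) t)
    (hψ : ∀ t, HasDerivAt ψ (ψ₁ t) t) (hψ₁ : ∀ t, HasDerivAt ψ₁ (ψ₂ t) t) (x : V) :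
    ∃ L : V →L[ℝ] V, HasFDerivAt (twist J a b c κ F f ψ ψ₁) L x ∧ ∀ v t r θ, v = prP a b x - c →
      t = ⟪b, x⟫ → r = ‖v‖ ^ 2 → θ = -2 * κ * (F t * ψ₁ r) → ∀ u, L u = u +
      (f₁ t * ψ r * ⟪b, u⟫ + f t * ψ₁ r * (2 * ⟪v, prP a b u⟫)) • a
      + (Real.cos θ - 1) • prP a b u + Real.sin θ • J (prP a b u)
      + (-2 * κ * (f t * ψ₁ r * ⟪b, u⟫ + F t * ψ₂ r * (2 * ⟪v, prP a b u⟫))) •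
          (- Real.sin θ • v + Real.cos θ • J v) := by
  have ht : HasFDerivAt (fun x : V => ⟪b, x⟫) (innerSL ℝ b) x := (innerSL ℝ b).hasFDerivAt
  have hv : HasFDerivAt (fun x : V => prP a b x - c) (prP a b) x :=
    (prP a b).hasFDerivAt.sub_const c
  have hJv : HasFDerivAt (fun x : V => J (prP a b x - c)) (J.comp (prP a b)) x :=
    J.hasFDerivAt.comp x hv
  have hr := hv.norm_sq
  have hft := (hf _).comp_hasFDerivAt x ht
  have hFt := (hF _).comp_hasFDerivAt x ht
  have hpr := (hψ _).comp_hasFDerivAt x hr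
  have hpr1 := (hψ₁ _).comp_hasFDerivAt x hr
  have hth := (hFt.mul hpr1).const_mul (-2 * κ)
  have hc := (Real.hasDerivAt_cos _).comp_hasFDerivAt x hth
  have hs := (Real.hasDerivAt_sin _).comp_hasFDerivAt x hth
  have H := (((hasFDerivAt_id x).add ((hft.mul hpr).smul_const a)).add
    ((hc.sub_const 1).smul hv)).add (hs.smul hJv)
  refine ⟨_, H, ?_⟩
  intro v t r θ h1 h2 h3 h4 u
  subst h1 h2 h3 h4
  simp [inner_sub_left]
  module

lemma twist_sympl (J : V →L[ℝ] V) (hJ2 : ∀ u, J (J u) = -u) (hJ : ∀ u v, ⟪J u, v⟫ = - ⟪u, J v⟫)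
    (a b v w w' : V) (κ : ℝ) (hκ : κ * κ = 1) (hab : J a = κ • b)
    (haa : ⟪a, a⟫ = 1) (hbb : ⟪b, b⟫ = 1) (hba : ⟪b, a⟫ = 0)
    (hv : ⟪a, v⟫ = 0 ∧ ⟪b, v⟫ = 0) (hw : ⟪a, w⟫ = 0 ∧ ⟪b, w⟫ = 0)
    (hw' : ⟪a, w'⟫ = 0 ∧ ⟪b, w'⟫ = 0) (y t y' t' θ A B C : ℝ) :
    ⟪(y + (A * t + B * (2 * ⟪v, w⟫))) • a + t • b + Real.cos θ • w + Real.sin θ • J w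
      + (-2 * κ * (B * t + C * (2 * ⟪v, w⟫))) • (- Real.sin θ • v + Real.cos θ • J v),
     J ((y' + (A * t' + B * (2 * ⟪v, w'⟫))) • a + t' • b + Real.cos θ • w' + Real.sin θ • J w'
      + (-2 * κ * (B * t' + C * (2 * ⟪v, w'⟫))) • (- Real.sin θ • v + Real.cos θ • J v))⟫
    = ⟪y • a + t • b + w, J (y' • a + t' • b + w')⟫ := by
  have hJb : J b = (-κ) • a := by
    have : J (J a) = κ • J b := by rw [hab, map_smul]
    rw [hJ2] at this
    have h2 : κ • (-a) = (κ * κ) • J b := by rw [this, smul_smul]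
    rw [hκ, one_smul] at h2
    rw [← h2]; simp
  have hab0 : ⟪a, b⟫ = 0 := by rw [real_inner_comm]; exact hba
  have aJ : ∀ u, ⟪a, J u⟫ = - κ * ⟪b, u⟫ := by
    intro u
    have := hJ a u
    rw [hab, inner_smul_left] at this
    simp at this; linarith
  have bJ : ∀ u, ⟪b, J u⟫ = κ * ⟪a, u⟫ := by
    intro u
    have := hJ b u
    rw [hJb, inner_smul_left] at this
    simp at this; linarith
  have h0 : ∀ u, ⟪u, J u⟫ = 0 := by
    intro u
    have := hJ u u
    rw [real_inner_comm] at this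
    linarith
  have sy : ∀ u z, ⟪u, J z⟫ = - ⟪z, J u⟫ := by
    intro u z
    have := hJ u z
    rw [real_inner_comm] at this
    linarith
  have va : ⟪v, a⟫ = 0 := by rw [real_inner_comm]; exact hv.1
  have vb : ⟪v, b⟫ = 0 := by rw [real_inner_comm]; exact hv.2
  have wa : ⟪w, a⟫ = 0 := by rw [real_inner_comm]; exact hw.1
  have wb : ⟪w, b⟫ = 0 := by rw [real_inner_comm]; exact hw.2
  have cs := Real.cos_sq_add_sin_sq θ
  simp only [map_add, map_smul, map_neg, inner_add_left, inner_add_right, inner_smul_left,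
    inner_smul_right, hJ2, hab, hJb, inner_neg_right, inner_neg_left, hJ, aJ, bJ, haa, hbb, hba,
    hab0, hv.1, hv.2, hw.1, hw.2, hw'.1, hw'.2, va, vb, wa, wb, h0, RCLike.conj_to_real, sy w' w, sy v w,
    sy w' v, real_inner_comm v w, real_inner_comm v w']
  generalize ⟪v, w⟫ = p
  generalize ⟪v, w'⟫ = p'
  generalize ⟪v, v⟫ = q
  generalize ⟪w, J w'⟫ = m
  generalize ⟪w, J v⟫ = m1
  generalize ⟪v, J w'⟫ = m2
  generalize ⟪w, w'⟫ = m3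
  generalize Real.cos θ = cc at *
  generalize Real.sin θ = ss at *
  have cs' : ss ^ 2 = 1 - cc ^ 2 := by linarith
  have hκ' : κ ^ 2 = 1 := by rw [pow_two]; exact hκ
  ring_nf
  simp only [cs', hκ']
  ring_nf
end Abstract

section Concrete
open scoped RealInnerProductSpace

abbrev EE (n : ℕ) := EuclideanSpace ℝ (Fin n ⊕ Fin n)

def Jc (n : ℕ) : EE n →L[ℝ] EE n := Matrix.toEuclideanCLM (𝕜 := ℝ) (Matrix.J (Fin n) ℝ)

def sg {n : ℕ} : Fin n ⊕ Fin n → ℝ := Sum.elim (fun _ => -1) (fun _ => 1)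

lemma sg_swap {n : ℕ} (j : Fin n ⊕ Fin n) : sg j.swap = - sg j := by
  cases j <;> simp [sg]

lemma sg_sq {n : ℕ} (j : Fin n ⊕ Fin n) : sg j * sg j = 1 := by
  cases j <;> simp [sg]

lemma Jc_apply {n : ℕ} (u : EE n) (j : Fin n ⊕ Fin n) : Jc n u j = sg j * u j.swap := by
  unfold Jc
  rw [Matrix.ofLp_toEuclideanCLM]
  cases j <;> simp [Matrix.J, sg, Matrix.mulVec, dotProduct, Matrix.one_apply]

lemma Jc_sq {n : ℕ} (u : EE n) : Jc n (Jc n u) = -u := by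
  ext j
  rw [Jc_apply, Jc_apply, sg_swap, Sum.swap_swap]
  have := sg_sq j
  simp only [PiLp.neg_apply]
  linear_combination (-u j) * this

lemma Jc_inner {n : ℕ} (u v : EE n) : ⟪Jc n u, v⟫ = - ⟪u, Jc n v⟫ := by
  simp only [PiLp.inner_apply, Jc_apply, RCLike.inner_apply, conj_trivial]
  rw [← Finset.sum_neg_distrib, ← Equiv.sum_comp (Equiv.sumComm (Fin n) (Fin n))]
  apply Finset.sum_congr rfl
  intro j _
  have : (Equiv.sumComm (Fin n) (Fin n)) j = j.swap := rfl
  rw [this, sg_swap, Sum.swap_swap]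
  ring

structure SymD {n : ℕ} (S : EE n → EE n) : Prop where
  ex : ∃ Sinv, ContDiff ℝ (⊤ : ℕ∞) S ∧ ContDiff ℝ (⊤ : ℕ∞) Sinv ∧
      Function.LeftInverse Sinv S ∧ Function.RightInverse Sinv S
  sym : ∀ x u u', ⟪fderiv ℝ S x u, Jc n (fderiv ℝ S x u')⟫ = ⟪u, Jc n u'⟫

lemma SymD.contDiff {n : ℕ} {S : EE n → EE n} (h : SymD S) : ContDiff ℝ (⊤ : ℕ∞) S := by
  obtain ⟨_, h, _⟩ := h.ex
  exact h

lemma SymD.diff {n : ℕ} {S : EE n → EE n} (h : SymD S) : Differentiable ℝ S :=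
  h.contDiff.differentiable (by simp)

lemma SymD.id {n : ℕ} : SymD (id : EE n → EE n) := by
  refine ⟨⟨_root_.id, contDiff_id, contDiff_id, fun x => rfl, fun x => rfl⟩, ?_⟩
  intro x u u'
  simp

lemma SymD.comp {n : ℕ} {S T : EE n → EE n} (hS : SymD S) (hT : SymD T) : SymD (S ∘ T) := by
  refine ⟨?_, ?_⟩
  · obtain ⟨Si, h1, h2, h3, h4⟩ := hS.ex
    obtain ⟨Ti, k1, k2, k3, k4⟩ := hT.ex
    exact ⟨Ti ∘ Si, h1.comp k1, k2.comp h2, h3.comp k3, h4.comp k4⟩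
  · intro x u u'
    rw [fderiv_comp x (hS.diff _) (hT.diff _)]
    simp only [ContinuousLinearMap.comp_apply]
    rw [hS.sym, hT.sym]

lemma SymD.matrix {n : ℕ} {S : EE n → EE n} (hS : SymD S) (x : EE n) :
    (matD S x)ᵀ * Matrix.J (Fin n) ℝ * matD S x = Matrix.J (Fin n) ℝ := by
  have hM : Matrix.toEuclideanCLM (𝕜 := ℝ) (matD S x) = fderiv ℝ S x := by
    unfold matD
    apply ContinuousLinearMap.coe_injective
    rw [Matrix.coe_toEuclideanCLM_eq_toEuclideanLin, Matrix.toEuclideanLin_eq_toLin_orthonormal]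
    exact Matrix.toLin_toMatrix _ _ _
  have h1 : (matD S x)ᵀ = star (matD S x) := by
    rw [Matrix.star_eq_conjTranspose, Matrix.conjTranspose_eq_transpose_of_trivial]
  apply EquivLike.injective (Matrix.toEuclideanCLM (𝕜 := ℝ) (n := Fin n ⊕ Fin n))
  rw [h1, map_mul, map_mul, map_star, hM]
  ext1 u'
  apply ext_inner_left ℝ
  intro u
  have := hS.sym x u u'
  rw [ContinuousLinearMap.star_eq_adjoint]
  rw [mul_apply_eq_comp, mul_apply_eq_comp,
    ContinuousLinearMap.adjoint_inner_right]
  exact this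

lemma SymD.det {n : ℕ} {S : EE n → EE n} (hS : SymD S) (x : EE n) :
    |(fderiv ℝ S x).det| = 1 := by
  have h := congrArg Matrix.det (hS.matrix x)
  rw [Matrix.det_mul, Matrix.det_mul, Matrix.det_transpose] at h
  have hJ := Matrix.J_det_mul_J_det (Fin n) ℝ
  have hd : (fderiv ℝ S x).det = (matD S x).det := by
    unfold matD
    rw [LinearMap.det_toMatrix]
  rw [hd]
  have h2 : (matD S x).det * (matD S x).det = 1 := by
    have h3 := congrArg (fun t => t * (Matrix.J (Fin n) ℝ).det) h
    rw [hJ] at h3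
    linear_combination h3 - (matD S x).det ^ 2 * hJ
  rw [← sq_eq_sq₀ (abs_nonneg _) zero_le_one, sq_abs]
  linarith [sq ((matD S x).det)]

lemma SymD.measure_preimage {n : ℕ} {S : EE n → EE n} (hS : SymD S) (Z : Set (EE n))
    (hZ : MeasurableSet Z) : volume (S ⁻¹' Z) = volume Z := by
  obtain ⟨Si, h1, h2, h3, h4⟩ := hS.ex
  have hm : MeasurableSet (S ⁻¹' Z) := h1.continuous.measurable hZ
  have := lintegral_abs_det_fderiv_eq_addHaar_image volume hm
    (f := S) (f' := fun x => fderiv ℝ S x)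
    (fun x _ => (hS.diff x).hasFDerivAt.hasFDerivWithinAt) (h3.injective.injOn)
  rw [image_preimage_eq Z h4.surjective] at this
  rw [← this]
  simp [hS.det]

/-- unit coordinate vector -/
def ev {n : ℕ} (k : Fin n ⊕ Fin n) : EE n := EuclideanSpace.single k 1

lemma inner_ev {n : ℕ} (k : Fin n ⊕ Fin n) (u : EE n) : ⟪ev k, u⟫ = u k := by
  simp [ev, EuclideanSpace.inner_single_left]

lemma ev_apply {n : ℕ} (k j : Fin n ⊕ Fin n) : (ev k : EE n) j = if j = k then 1 else 0 := by
  simp [ev, Pi.single_apply]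

lemma swap_ne {n : ℕ} (k : Fin n ⊕ Fin n) : k.swap ≠ k := by cases k <;> simp

lemma Jc_ev {n : ℕ} (k : Fin n ⊕ Fin n) : Jc n (ev k) = (-sg k) • ev k.swap := by
  ext j
  rw [Jc_apply, ev_apply, PiLp.smul_apply, ev_apply, smul_eq_mul]
  by_cases h : j = k.swap
  · subst h
    simp [sg_swap]
  · have : j.swap ≠ k := by
      rintro rfl; simp at h
    simp [h, this]

/-- projection forgetting coordinates `k` and its conjugate -/
def Pk {n : ℕ} (k : Fin n ⊕ Fin n) : EE n →L[ℝ] EE n := prP (ev k) (ev k.swap)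

lemma Pk_apply {n : ℕ} (k : Fin n ⊕ Fin n) (u : EE n) (j : Fin n ⊕ Fin n) :
    Pk k u j = if j = k ∨ j = k.swap then 0 else u j := by
  unfold Pk
  rw [prP_apply]
  simp only [inner_ev, PiLp.sub_apply, PiLp.smul_apply, ev_apply, smul_eq_mul]
  have := swap_ne k
  by_cases h : j = k
  · subst h; simp [this.symm]
  · by_cases h' : j = k.swap
    · subst h'; simp [this]
    · simp [h, h']

lemma Pk_Pk {n : ℕ} (k : Fin n ⊕ Fin n) (u : EE n) : Pk k (Pk k u) = Pk k u := by
  ext j; simp only [Pk_apply]; split_ifs <;> rfl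

lemma Pk_J {n : ℕ} (k : Fin n ⊕ Fin n) (u : EE n) : Pk k (Jc n u) = Jc n (Pk k u) := by
  ext j
  simp only [Pk_apply, Jc_apply]
  have h1 : j.swap = k ↔ j = k.swap := ⟨fun h => by rw [← h]; simp, fun h => by rw [h]; simp⟩
  have h2 : j.swap = k.swap ↔ j = k :=
    ⟨fun h => by simpa using congrArg Sum.swap h, fun h => by rw [h]⟩
  simp only [h1, h2]
  by_cases h : j = k <;> by_cases h' : j = k.swap <;> simp [h, h']

lemma Pk_ev {n : ℕ} (k : Fin n ⊕ Fin n) : Pk k (ev k) = 0 := by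
  ext j; simp only [Pk_apply, ev_apply]; split_ifs <;> simp_all

/-- the concrete twist -/
def tw {n : ℕ} (k : Fin n ⊕ Fin n) (c : EE n) (F f ψ ψ₁ : ℝ → ℝ) : EE n → EE n :=
  twist (Jc n) (ev k) (ev k.swap) c (-sg k) F f ψ ψ₁

lemma tw_eq {n : ℕ} (k : Fin n ⊕ Fin n) (c : EE n) (F f ψ ψ₁ : ℝ → ℝ) (x : EE n) :
    ∃ θ : ℝ, θ = 2 * sg k * (F (x k.swap) * ψ₁ (‖Pk k x - c‖ ^ 2)) ∧
    tw k c F f ψ ψ₁ x = x + (f (x k.swap) * ψ (‖Pk k x - c‖ ^ 2)) • ev k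
    + (Real.cos θ - 1) • (Pk k x - c) + Real.sin θ • Jc n (Pk k x - c) := by
  refine ⟨_, rfl, ?_⟩
  unfold tw twist
  rw [inner_ev]
  have : -2 * (-sg k) = 2 * sg k := by ring
  rw [this]
  rfl

lemma tw_Pk {n : ℕ} (k : Fin n ⊕ Fin n) (c : EE n) (hc : Pk k c = c) (F f ψ ψ₁ : ℝ → ℝ)
    (x : EE n) (θ : ℝ) (hθ : θ = 2 * sg k * (F (x k.swap) * ψ₁ (‖Pk k x - c‖ ^ 2))) :
    Pk k (tw k c F f ψ ψ₁ x) - c = Real.cos θ • (Pk k x - c) + Real.sin θ • Jc n (Pk k x - c) := by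
  obtain ⟨θ', h1, h2⟩ := tw_eq k c F f ψ ψ₁ x
  have : θ' = θ := by rw [h1, hθ]
  subst this
  rw [h2]
  simp only [map_add, map_smul, Pk_ev, Pk_J, map_sub, Pk_Pk, hc]
  module

lemma Jc_norm {n : ℕ} (u : EE n) : ‖Jc n u‖ = ‖u‖ := by
  have : ‖Jc n u‖ ^ 2 = ‖u‖ ^ 2 := by
    rw [← real_inner_self_eq_norm_sq, ← real_inner_self_eq_norm_sq, Jc_inner, Jc_sq]; simp
  rwa [sq_eq_sq₀ (norm_nonneg _) (norm_nonneg _)] at this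

lemma rot_norm {n : ℕ} (v : EE n) (θ : ℝ) :
    ‖Real.cos θ • v + Real.sin θ • Jc n v‖ ^ 2 = ‖v‖ ^ 2 := by
  have h0 : ⟪v, Jc n v⟫ = 0 := by
    have := Jc_inner v v
    rw [real_inner_comm] at this
    linarith
  rw [← real_inner_self_eq_norm_sq, ← real_inner_self_eq_norm_sq]
  simp only [inner_add_left, inner_add_right, inner_smul_left, inner_smul_right, Jc_inner, Jc_sq,
    h0, RCLike.conj_to_real, inner_neg_right]
  linear_combination (⟪v, v⟫) * Real.cos_sq_add_sin_sq θ

lemma tw_norm {n : ℕ} (k : Fin n ⊕ Fin n) (c : EE n) (hc : Pk k c = c) (F f ψ ψ₁ : ℝ → ℝ)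
    (x : EE n) : ‖Pk k (tw k c F f ψ ψ₁ x) - c‖ ^ 2 = ‖Pk k x - c‖ ^ 2 := by
  rw [tw_Pk k c hc F f ψ ψ₁ x _ rfl, rot_norm]

lemma tw_swap {n : ℕ} (k : Fin n ⊕ Fin n) (c : EE n) (hc : Pk k c = c) (F f ψ ψ₁ : ℝ → ℝ)
    (x : EE n) : (tw k c F f ψ ψ₁ x) k.swap = x k.swap := by
  obtain ⟨θ, h1, h2⟩ := tw_eq k c F f ψ ψ₁ x
  rw [h2]
  have h3 : Pk k x - c = Pk k (x - c) := by rw [map_sub, hc]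
  rw [h3, ← Pk_J]
  simp [Pk_apply, ev_apply, swap_ne k]

lemma tw_inv {n : ℕ} (k : Fin n ⊕ Fin n) (c : EE n) (hc : Pk k c = c) (F f ψ ψ₁ : ℝ → ℝ)
    (x : EE n) : tw k c (fun t => - F t) (fun t => - f t) ψ ψ₁ (tw k c F f ψ ψ₁ x) = x := by
  obtain ⟨θ, h1, h2⟩ := tw_eq k c F f ψ ψ₁ x
  obtain ⟨θ', h1', h2'⟩ := tw_eq k c (fun t => - F t) (fun t => - f t) ψ ψ₁ (tw k c F f ψ ψ₁ x)
  rw [tw_norm k c hc, tw_swap k c hc] at h1' h2'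
  have hθ : θ' = -θ := by rw [h1', h1]; ring
  rw [h2', tw_Pk k c hc F f ψ ψ₁ x θ h1, hθ, Real.cos_neg, Real.sin_neg, h2]
  simp only [map_add, map_smul, Jc_sq]
  have cs := Real.cos_sq_add_sin_sq θ
  have cs' : Real.sin θ ^ 2 = 1 - Real.cos θ ^ 2 := by linarith
  match_scalars <;> (try ring_nf) <;> (try rw [cs']) <;> (try ring_nf)

lemma tw_symD {n : ℕ} (k : Fin n ⊕ Fin n) (c : EE n) (hc : Pk k c = c) (F ψ : ℝ → ℝ)
    (hF : ContDiff ℝ (⊤ : ℕ∞) F) (hψ : ContDiff ℝ (⊤ : ℕ∞) ψ) :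
    SymD (tw k c F (deriv F) ψ (deriv ψ)) := by
  have hf := (contDiff_infty_iff_deriv.1 hF).2
  have hψ1 := (contDiff_infty_iff_deriv.1 hψ).2
  refine ⟨⟨tw k c (fun t => - F t) (fun t => - deriv F t) ψ (deriv ψ),
    twist_contDiff _ _ _ _ _ _ _ _ _ hF hf hψ hψ1,
    twist_contDiff _ _ _ _ _ _ _ _ _ hF.neg hf.neg hψ hψ1, ?_, ?_⟩, ?_⟩
  · intro x; exact tw_inv k c hc _ _ _ _ x
  · intro x
    have := tw_inv k c hc (fun t => - F t) (fun t => - deriv F t) ψ (deriv ψ) x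
    simpa using this
  · intro x u u'
    have d : ∀ G : ℝ → ℝ, ContDiff ℝ (⊤ : ℕ∞) G → ∀ t, HasDerivAt G (deriv G t) t :=
      fun G hG t => ((hG.differentiable (by simp)) t).hasDerivAt
    obtain ⟨L, hL, hLu⟩ := twist_hasFDerivAt (Jc n) (ev k) (ev k.swap) c (-sg k) F (deriv F)
      (deriv (deriv F)) ψ (deriv ψ) (deriv (deriv ψ)) (d _ hF) (d _ hf) (d _ hψ) (d _ hψ1) x
    have hfd : fderiv ℝ (tw k c F (deriv F) ψ (deriv ψ)) x = L := hL.fderiv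
    rw [hfd]
    have hLu := hLu _ _ _ _ rfl rfl rfl rfl
    set v := prP (ev k) (ev k.swap) x - c with hv
    have perp : ∀ z : EE n, ⟪ev k, Pk k z⟫ = 0 ∧ ⟪ev k.swap, Pk k z⟫ = 0 := by
      intro z
      simp [inner_ev, Pk_apply]
    have hvP : v = Pk k (x - c) := by rw [map_sub, hc]; rfl
    have key := twist_sympl (Jc n) Jc_sq Jc_inner (ev k) (ev k.swap) v (Pk k u) (Pk k u') (-sg k)
      (by have := sg_sq k; linarith) (Jc_ev k) (by rw [inner_ev, ev_apply]; simp)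
      (by rw [inner_ev, ev_apply]; simp) (by rw [inner_ev, ev_apply]; simp [swap_ne])
      (by rw [hvP]; exact perp _) (perp _) (perp _) ⟪ev k, u⟫ ⟪ev k.swap, u⟫ ⟪ev k, u'⟫ ⟪ev k.swap, u'⟫
      (-2 * -sg k * (F (inner ℝ (ev k.swap) x) * deriv ψ (‖v‖ ^ 2)))
      (deriv (deriv F) (inner ℝ (ev k.swap) x) * ψ (‖v‖ ^ 2))
      (deriv F (inner ℝ (ev k.swap) x) * deriv ψ (‖v‖ ^ 2))
      (F (inner ℝ (ev k.swap) x) * deriv (deriv ψ) (‖v‖ ^ 2))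
    have dec : ∀ z : EE n, z = ⟪ev k, z⟫ • ev k + ⟪ev k.swap, z⟫ • ev k.swap + Pk k z := by
      intro z
      unfold Pk
      rw [prP_apply]
      abel
    rw [← dec u, ← dec u'] at key
    rw [← key, hLu u, hLu u']
    have e : ∀ (z : EE n) (A B C D : ℝ) (m : EE n), z + B • ev k + (C - 1) • Pk k z + D • Jc n (Pk k z) + m
        = (⟪ev k, z⟫ + B) • ev k + ⟪ev k.swap, z⟫ • ev k.swap + C • Pk k z + D • Jc n (Pk k z) + m := by
      intro z A B C D m
      nth_rewrite 1 [dec z]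
      module
    have e1 := fun z B C D m => e z 0 B C D m
    unfold Pk at e1 ⊢
    rw [e1, e1]
end Concrete

section Shears
open scoped Manifold Topology

lemma smooth_urysohn (s t : Set ℝ) (hs : IsClosed s) (ht : IsClosed t) (hd : Disjoint s t) :
    ∃ g : ℝ → ℝ, ContDiff ℝ (⊤ : ℕ∞) g ∧ (∀ᶠ x in 𝓝ˢ s, g x = 0) ∧ (∀ᶠ x in 𝓝ˢ t, g x = 1) ∧
      ∀ x, g x ∈ Icc (0 : ℝ) 1 := by
  obtain ⟨g, h0, h1, h2⟩ := exists_contMDiffMap_zero_one_nhds_of_isClosed (n := (⊤ : ℕ∞))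
    𝓘(ℝ, ℝ) hs ht hd
  exact ⟨g, g.contMDiff.contDiff, h0, h1, h2⟩

lemma deriv_zero_of_nhdsSet (g : ℝ → ℝ) (s : Set ℝ) (c : ℝ) (h : ∀ᶠ x in 𝓝ˢ s, g x = c) (x : ℝ)
    (hx : x ∈ s) : deriv g x = 0 := by
  have h1 : ∀ᶠ y in 𝓝 x, g y = c := Filter.Eventually.filter_mono (nhds_le_nhdsSet hx) h
  have : g =ᶠ[𝓝 x] fun _ => c := h1
  rw [this.deriv_eq]; simp

lemma ball_lemma {n : ℕ} (k : Fin n ⊕ Fin n) (c : EE n) (hc : Pk k c = c) (r η : ℝ) (hr : 0 ≤ r)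
    (hη : 0 < η) (F : ℝ → ℝ) (hF : ContDiff ℝ (⊤ : ℕ∞) F) (H : ℝ) (hH : ∀ t, |deriv F t| ≤ H) :
    ∃ S : EE n → EE n, SymD S ∧
      (∀ x, ‖Pk k x - c‖ ≤ r → S x = x + deriv F (x k.swap) • ev k) ∧
      (∀ x, r + η ≤ ‖Pk k x - c‖ → S x = x) ∧
      (∀ x, ‖Pk k (S x) - c‖ = ‖Pk k x - c‖) ∧
      (∀ x, ‖S x - x‖ ≤ H + 3 * (r + η)) := by
  obtain ⟨ψ, hψ, h0, h1, h2⟩ := smooth_urysohn (Ici ((r + η) ^ 2)) (Iic (r ^ 2)) isClosed_Ici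
    isClosed_Iic (by
      rw [Set.disjoint_left]
      intro x hx hx'
      simp only [mem_Ici, mem_Iic] at hx hx'
      nlinarith)
  have z0 := fun x hx => Filter.Eventually.self_of_nhdsSet h0 (x := x) hx
  have z1 := fun x hx => Filter.Eventually.self_of_nhdsSet h1 (x := x) hx
  have d0 := deriv_zero_of_nhdsSet _ _ _ h0
  have d1 := deriv_zero_of_nhdsSet _ _ _ h1
  have hout : ∀ x, r + η ≤ ‖Pk k x - c‖ → tw k c F (deriv F) ψ (deriv ψ) x = x := by
    intro x hx
    obtain ⟨θ, e1, e2⟩ := tw_eq k c F (deriv F) ψ (deriv ψ) x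
    have hm : ‖Pk k x - c‖ ^ 2 ∈ Ici ((r + η) ^ 2) := by
      simp only [mem_Ici]; gcongr
    rw [d0 _ hm] at e1
    rw [z0 _ hm] at e2
    simp only [mul_zero] at e1
    rw [e2, e1]; simp
  refine ⟨tw k c F (deriv F) ψ (deriv ψ), tw_symD k c hc F ψ hF hψ, ?_, hout, ?_, ?_⟩
  · intro x hx
    obtain ⟨θ, e1, e2⟩ := tw_eq k c F (deriv F) ψ (deriv ψ) x
    have hm : ‖Pk k x - c‖ ^ 2 ∈ Iic (r ^ 2) := by
      simp only [mem_Iic]; gcongr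
    rw [d1 _ hm] at e1
    rw [z1 _ hm] at e2
    simp only [mul_zero] at e1
    rw [e2, e1]; simp
  · intro x
    have := tw_norm k c hc F (deriv F) ψ (deriv ψ) x
    rwa [sq_eq_sq₀ (norm_nonneg _) (norm_nonneg _)] at this
  · intro x
    have hH0 : 0 ≤ H := (abs_nonneg _).trans (hH 0)
    by_cases hx : r + η ≤ ‖Pk k x - c‖
    · rw [hout x hx]; simp; positivity
    push Not at hx
    obtain ⟨θ, e1, e2⟩ := tw_eq k c F (deriv F) ψ (deriv ψ) x
    rw [e2]
    have e3 : x + (deriv F (x k.swap) * ψ (‖Pk k x - c‖ ^ 2)) • ev k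
      + (Real.cos θ - 1) • (Pk k x - c) + Real.sin θ • Jc n (Pk k x - c) - x =
      (deriv F (x k.swap) * ψ (‖Pk k x - c‖ ^ 2)) • ev k
      + (Real.cos θ - 1) • (Pk k x - c) + Real.sin θ • Jc n (Pk k x - c) := by abel
    rw [e3]
    have n1 : ‖(deriv F (x k.swap) * ψ (‖Pk k x - c‖ ^ 2)) • (ev k : EE n)‖ ≤ H := by
      rw [norm_smul]
      have : ‖(ev k : EE n)‖ = 1 := by simp [ev]
      rw [this, mul_one, Real.norm_eq_abs, abs_mul, abs_of_nonneg (h2 _).1]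
      calc _ ≤ H * 1 := mul_le_mul (hH _) (h2 _).2 (h2 _).1 hH0
        _ = H := mul_one H
    have n2 : ‖(Real.cos θ - 1) • (Pk k x - c)‖ ≤ 2 * (r + η) := by
      rw [norm_smul, Real.norm_eq_abs]
      have : |Real.cos θ - 1| ≤ 2 := by
        rw [abs_le]; constructor <;> linarith [Real.neg_one_le_cos θ, Real.cos_le_one θ]
      exact mul_le_mul this hx.le (norm_nonneg _) (by norm_num)
    have n3 : ‖Real.sin θ • Jc n (Pk k x - c)‖ ≤ r + η := by
      rw [norm_smul, Jc_norm, Real.norm_eq_abs]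
      calc _ ≤ 1 * (r + η) := mul_le_mul (Real.abs_sin_le_one θ) hx.le (norm_nonneg _) (by norm_num)
        _ = _ := one_mul _
    have := norm_add₃_le (a := (deriv F (x k.swap) * ψ (‖Pk k x - c‖ ^ 2)) • (ev k : EE n))
      (b := (Real.cos θ - 1) • (Pk k x - c)) (c := Real.sin θ • Jc n (Pk k x - c))
    linarith

lemma multi_ball {n : ℕ} (k : Fin n ⊕ Fin n) (F : ℝ → ℝ) (hF : ContDiff ℝ (⊤ : ℕ∞) F)
    (H : ℝ) (hH : ∀ t, |deriv F t| ≤ H) (r : EE n → ℝ) (t : Finset (EE n)) :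
    ∀ Ω : Set (EE n), IsOpen Ω →
    (∀ c ∈ t, Pk k c = c ∧ 0 ≤ r c ∧ r c ≤ 1 ∧ closedBall c (r c) ⊆ Ω) →
    ((t : Set (EE n)).PairwiseDisjoint fun c => closedBall c (r c)) →
    ∃ S : EE n → EE n, SymD S ∧
      (∀ x, Pk k x ∈ (⋃ c ∈ t, closedBall c (r c)) → S x = x + deriv F (x k.swap) • ev k) ∧
      (∀ x, Pk k x ∉ Ω → S x = x) ∧ (∀ x, Pk k x ∈ Ω → Pk k (S x) ∈ Ω) ∧
      (∀ x, ‖S x - x‖ ≤ H + 6) := by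
  have hH0 : 0 ≤ H := (abs_nonneg _).trans (hH 0)
  induction t using Finset.induction_on with
  | empty =>
    intro Ω _ _ _
    refine ⟨id, SymD.id, by simp, by simp, by simp, ?_⟩
    intro x; simp; positivity
  | insert c t hct ih =>
    intro Ω hΩ hb hd
    have hbc := hb c (Finset.mem_insert_self _ _)
    set G : Set (EE n) := Ω ∩ (⋃ c' ∈ t, closedBall c' (r c'))ᶜ with hG
    have hGo : IsOpen G := by
      refine hΩ.inter (isOpen_compl_iff.2 ?_)
      exact t.finite_toSet.isClosed_biUnion (fun _ _ => isClosed_closedBall)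
    have hcG : closedBall c (r c) ⊆ G := by
      refine subset_inter hbc.2.2.2 ?_
      rw [subset_compl_iff_disjoint_right, disjoint_iUnion₂_right]
      intro c' hc'
      exact hd (by simp) (by simp [hc']) (by rintro rfl; exact hct hc')
    obtain ⟨η', hη', hsub⟩ := (isCompact_closedBall c (r c)).exists_cthickening_subset_open hGo hcG
    obtain ⟨η, hη0, hη1, hηη⟩ : ∃ η : ℝ, 0 < η ∧ η ≤ 1 ∧ η ≤ η' :=
      ⟨min 1 η', by positivity, min_le_left _ _, min_le_right _ _⟩
    have hsub2 : closedBall c (r c + η) ⊆ G := by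
      refine Subset.trans ?_ hsub
      rw [cthickening_closedBall hη'.le hbc.2.1]
      exact closedBall_subset_closedBall (by linarith)
    set Ω' : Set (EE n) := Ω \ closedBall c (r c + η) with hΩ'
    have hΩ'o : IsOpen Ω' := hΩ.sdiff isClosed_closedBall
    obtain ⟨S, hS, s1, s2, s3, s4⟩ := ih Ω' hΩ'o (by
      intro c' hc'
      obtain ⟨q1, q2, q3, q4⟩ := hb c' (Finset.mem_insert_of_mem hc')
      refine ⟨q1, q2, q3, ?_⟩
      intro y hy
      refine ⟨q4 hy, fun hy' => ?_⟩
      exact (hsub2 hy').2 (mem_biUnion hc' hy)) (hd.subset (by simp))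
    obtain ⟨T, hT, t1, t2, t3, t4⟩ := ball_lemma k c hbc.1 (r c) η hbc.2.1 hη0 F hF H hH
    have hTΩ' : ∀ x, Pk k x ∈ Ω' → T x = x := by
      intro x hx
      apply t2
      have := hx.2
      rw [mem_closedBall, dist_eq_norm] at this
      linarith
    have key : ∀ x, (Pk k x ∈ Ω' → T (S x) = S x) ∧ (Pk k x ∉ Ω' → T (S x) = T x) := by
      intro x
      exact ⟨fun h => hTΩ' _ (s3 x h), fun h => by rw [s2 x h]⟩
    refine ⟨T ∘ S, hT.comp hS, ?_, ?_, ?_, ?_⟩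
    · intro x hx
      simp only [Function.comp]
      rw [Finset.set_biUnion_insert] at hx
      rcases hx with hx | hx
      · rw [(key x).2, t1]
        · rw [← dist_eq_norm]; exact hx
        · intro h
          exact h.2 (closedBall_subset_closedBall (by linarith) hx)
      · have hmem : Pk k x ∈ Ω' := by
          simp only [mem_iUnion] at hx
          obtain ⟨c', hc', hx⟩ := hx
          refine ⟨(hb c' (Finset.mem_insert_of_mem hc')).2.2.2 hx, fun h => ?_⟩
          exact (hsub2 h).2 (mem_biUnion hc' hx)
        rw [(key x).1 hmem, s1 x hx]
    · intro x hx
      simp only [Function.comp]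
      rw [(key x).2 (fun h => hx h.1)]
      apply t2
      by_contra hcon
      push Not at hcon
      apply hx
      exact (hsub2 (by rw [mem_closedBall, dist_eq_norm]; linarith)).1
    · intro x hx
      simp only [Function.comp]
      by_cases hx' : Pk k x ∈ Ω'
      · rw [(key x).1 hx']; exact (s3 x hx').1
      · rw [(key x).2 hx']
        have : Pk k x ∈ closedBall c (r c + η) := by
          by_contra h; exact hx' ⟨hx, h⟩
        refine (hsub2 ?_).1
        rw [mem_closedBall, dist_eq_norm] at this ⊢
        rw [t3]; exact this
    · intro x
      simp only [Function.comp]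
      by_cases hx' : Pk k x ∈ Ω'
      · rw [(key x).1 hx']; exact s4 x
      · rw [(key x).2 hx']
        refine (t4 x).trans ?_
        linarith [hbc.2.2.1]

/-- Maps approximable by symplectic diffeomorphisms with bounded displacement. -/
def Appr {n : ℕ} (T : EE n → EE n) : Prop :=
  ∃ M : ℝ, 0 ≤ M ∧ ∀ R : ℝ, ∀ δ : ENNReal, 0 < δ → ∃ S : EE n → EE n, SymD S ∧
    (∀ x, ‖S x - x‖ ≤ M) ∧ ∃ Z : Set (EE n), MeasurableSet Z ∧ volume Z ≤ δ ∧
      ∀ x, ‖x‖ ≤ R → x ∉ Z → S x = T x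

lemma Appr.id {n : ℕ} : Appr (id : EE n → EE n) :=
  ⟨0, le_refl _, fun R δ hδ => ⟨_root_.id, SymD.id, by simp, ∅, MeasurableSet.empty, by simp,
    by simp⟩⟩

lemma Appr.comp {n : ℕ} {T₂ T₁ : EE n → EE n} (h2 : Appr T₂) (h1 : Appr T₁) :
    Appr (T₂ ∘ T₁) := by
  obtain ⟨M₁, hM₁, h1⟩ := h1
  obtain ⟨M₂, hM₂, h2⟩ := h2
  refine ⟨M₁ + M₂, by positivity, ?_⟩
  intro R δ hδ
  have hδ2 : 0 < δ / 2 := ENNReal.half_pos hδ.ne'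
  obtain ⟨S₁, hS₁, b1, Z₁, m1, v1, e1⟩ := h1 R (δ / 2) hδ2
  obtain ⟨S₂, hS₂, b2, Z₂, m2, v2, e2⟩ := h2 (R + M₁) (δ / 2) hδ2
  refine ⟨S₂ ∘ S₁, hS₂.comp hS₁, ?_, Z₁ ∪ S₁ ⁻¹' Z₂,
    m1.union (hS₁.contDiff.continuous.measurable m2), ?_, ?_⟩
  · intro x
    have := norm_add_le (S₂ (S₁ x) - S₁ x) (S₁ x - x)
    simp only [sub_add_sub_cancel] at this
    have h3 := b1 x
    have h4 := b2 (S₁ x)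
    simp only [Function.comp]
    linarith
  · calc _ ≤ volume Z₁ + volume (S₁ ⁻¹' Z₂) := measure_union_le _ _
      _ ≤ δ / 2 + δ / 2 := by
        rw [hS₁.measure_preimage Z₂ m2]; gcongr
      _ = δ := ENNReal.add_halves δ
  · intro x hx hZ
    simp only [mem_union, not_or] at hZ
    have hR : ‖S₁ x‖ ≤ R + M₁ := by
      have := norm_add_le x (S₁ x - x)
      simp only [add_sub_cancel] at this
      linarith [b1 x]
    simp only [Function.comp]
    rw [e2 _ hR hZ.2, e1 x hx hZ.1]

open Classical in
def shear {n : ℕ} (k : Fin n ⊕ Fin n) (h : ℝ) (A : Set ℝ) (W : Set (EE n)) (x : EE n) : EE n :=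
  x + (if x k.swap ∈ A ∧ Pk k x ∈ W then h else 0) • ev k

lemma outer_open {X : Type*} [TopologicalSpace X] [MeasurableSpace X] [BorelSpace X]
    (μ : Measure X) [IsFiniteMeasure μ] [μ.OuterRegular] (W : Set X) (hW : MeasurableSet W)
    (δ : ENNReal) (hδ : 0 < δ) : ∃ Ω : Set X, IsOpen Ω ∧ W ⊆ Ω ∧ μ (Ω \ W) ≤ δ := by
  obtain ⟨Ω, h1, h2, h3⟩ := W.exists_isOpen_lt_add (μ := μ) (measure_ne_top μ W) hδ.ne'
  refine ⟨Ω, h2, h1, ?_⟩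
  rw [measure_diff h1 hW.nullMeasurableSet (measure_ne_top μ W)]
  exact tsub_le_iff_left.2 h3.le

lemma finite_balls {n : ℕ} (k : Fin n ⊕ Fin n) (μ : Measure (EE n)) [IsFiniteMeasure μ]
    (Ω : Set (EE n)) (hΩ : IsOpen Ω) (δ : ENNReal) (hδ : 0 < δ) :
    ∃ (t : Finset (EE n)) (r : EE n → ℝ),
      (∀ c ∈ t, Pk k c = c ∧ 0 ≤ r c ∧ r c ≤ 1 ∧ closedBall c (r c) ⊆ Ω) ∧
      ((t : Set (EE n)).PairwiseDisjoint fun c => closedBall c (r c)) ∧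
      μ ((Ω ∩ {c | Pk k c = c}) \ ⋃ c ∈ t, closedBall c (r c)) ≤ δ := by
  obtain ⟨t, r, ht, hts, hr, hμ, hd⟩ := Besicovitch.exists_disjoint_closedBall_covering_ae μ
    (fun c => {r | closedBall c r ⊆ Ω}) (Ω ∩ {c | Pk k c = c}) (by
      intro x hx δ hδ
      obtain ⟨ε, hε, h⟩ := Metric.isOpen_iff.1 hΩ x hx.1
      refine ⟨min (ε / 2) (δ / 2), ?_, by constructor <;> simp [hε, hδ]⟩
      simp only [mem_setOf_eq]
      refine (closedBall_subset_ball ?_).trans h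
      exact lt_of_le_of_lt (min_le_left _ _) (by linarith)) (fun _ => 1) (by simp)
  have hsm : MeasurableSet (Ω ∩ {c | Pk k c = c}) :=
    hΩ.measurableSet.inter (isClosed_eq (Pk k).continuous continuous_id).measurableSet
  have : Countable t := ht.to_subtype
  have hlim := tendsto_measure_iInter_atTop (μ := μ) (ι := Finset t)
    (s := fun u => (Ω ∩ {c | Pk k c = c}) \ ⋃ c ∈ u, closedBall (c : EE n) (r c))
    (fun u => (hsm.diff (u.finite_toSet.isClosed_biUnion
      (fun _ _ => isClosed_closedBall)).measurableSet).nullMeasurableSet)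
    (by
      intro u v huv
      exact diff_subset_diff_right (biUnion_subset_biUnion_left huv))
    ⟨∅, measure_ne_top _ _⟩
  have h0 : μ (⋂ u : Finset t, (Ω ∩ {c | Pk k c = c}) \ ⋃ c ∈ u, closedBall (c : EE n) (r c)) = 0 := by
    refine measure_mono_null ?_ hμ
    intro x hx
    simp only [mem_iInter] at hx
    refine ⟨(hx ∅).1, ?_⟩
    intro hx'
    simp only [mem_iUnion] at hx'
    obtain ⟨c, hc, hxc⟩ := hx'
    refine (hx {⟨c, hc⟩}).2 ?_
    simpa using hxc
  rw [h0] at hlim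
  obtain ⟨u, hu⟩ := (hlim.eventually (gt_mem_nhds hδ)).exists
  refine ⟨u.map (Function.Embedding.subtype _), r, ?_, ?_, ?_⟩
  · intro c hc
    simp only [Finset.mem_map, Function.Embedding.subtype_apply] at hc
    obtain ⟨⟨c, hct⟩, _, rfl⟩ := hc
    exact ⟨(hts hct).2, (hr c hct).2.1.le, (hr c hct).2.2.le, (hr c hct).1⟩
  · apply hd.subset
    intro c hc
    simp only [Finset.coe_map, Function.Embedding.subtype_apply] at hc
    obtain ⟨⟨c, hct⟩, _, rfl⟩ := hc
    exact hct
  · refine le_trans (measure_mono ?_) hu.le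
    apply diff_subset_diff_right
    intro x hx
    simp only [mem_iUnion] at hx ⊢
    obtain ⟨c, hc, hx⟩ := hx
    exact ⟨c, by simpa using hc, hx⟩

lemma exists_antideriv (f : ℝ → ℝ) (hf : ContDiff ℝ (⊤ : ℕ∞) f) :
    ∃ F : ℝ → ℝ, ContDiff ℝ (⊤ : ℕ∞) F ∧ deriv F = f := by
  have hd : ∀ t, HasDerivAt (fun t => ∫ s in (0 : ℝ)..t, f s) (f t) t := fun t =>
    intervalIntegral.integral_hasDerivAt_right (hf.continuous.intervalIntegrable _ _)
      (hf.continuous.stronglyMeasurableAtFilter _ _) hf.continuous.continuousAt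
  have he : deriv (fun t => ∫ s in (0 : ℝ)..t, f s) = f := funext fun t => (hd t).deriv
  refine ⟨_, contDiff_infty_iff_deriv.2 ⟨fun t => (hd t).differentiableAt, ?_⟩, he⟩
  rw [he]; exact hf

lemma Appr.shear {n : ℕ} (k : Fin n ⊕ Fin n) (h : ℝ) (A : Set ℝ) (hA : MeasurableSet A)
    (W : Set (EE n)) (hW : MeasurableSet W) : Appr (shear k h A W) := by
  refine ⟨|h| + 6, by positivity, ?_⟩
  intro R δ hδ
  have hδ4 : 0 < δ / 2 / 2 := ENNReal.half_pos (ENNReal.half_pos hδ.ne').ne'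
  have hle : δ / 2 / 2 + δ / 2 / 2 + (δ / 2 / 2 + δ / 2 / 2) = δ := by
    rw [ENNReal.add_halves, ENNReal.add_halves]
  set β : Measure (EE n) := volume.restrict (closedBall 0 R) with hβ
  have : IsFiniteMeasure β := ⟨by
    rw [hβ, Measure.restrict_apply_univ]; exact measure_closedBall_lt_top⟩
  have mc : Measurable (fun x : EE n => x k.swap) := by fun_prop
  have mP : Measurable (fun x : EE n => Pk k x) := (Pk k).continuous.measurable
  set ν : Measure ℝ := β.map (fun x : EE n => x k.swap) with hν
  set μ : Measure (EE n) := β.map (fun x : EE n => Pk k x) with hμ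
  have : IsFiniteMeasure ν := Measure.isFiniteMeasure_map _ _
  have : IsFiniteMeasure μ := Measure.isFiniteMeasure_map _ _
  obtain ⟨O, hO, hAO, vO⟩ := outer_open ν A hA _ hδ4
  obtain ⟨K', hK', hAK', vK'⟩ := outer_open ν Aᶜ hA.compl _ hδ4
  obtain ⟨Ω, hΩ, hWΩ, vΩ⟩ := outer_open μ W hW _ hδ4
  obtain ⟨t, r, ht, hd, vt⟩ := finite_balls k μ Ω hΩ _ hδ4
  obtain ⟨g, hg, g0, g1, g01⟩ := smooth_urysohn Oᶜ K'ᶜ hO.isClosed_compl hK'.isClosed_compl (by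
    rw [Set.disjoint_left]
    intro x hx hx'
    by_cases hxA : x ∈ A
    · exact hx (hAO hxA)
    · exact hx' (hAK' hxA))
  have g0 := fun x hx => Filter.Eventually.self_of_nhdsSet g0 (x := x) hx
  have g1 := fun x hx => Filter.Eventually.self_of_nhdsSet g1 (x := x) hx
  obtain ⟨F, hF, hFd⟩ := exists_antideriv (fun t => h * g t) (contDiff_const.mul hg)
  obtain ⟨S, hS, s1, s2, s3, s4⟩ := multi_ball k F hF |h| (by
    intro t
    rw [hFd]
    simp only [abs_mul, abs_of_nonneg (g01 t).1]
    exact mul_le_of_le_one_right (abs_nonneg _) (g01 t).2) r t Ω hΩ ht hd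
  set U : Set (EE n) := (Ω ∩ {c | Pk k c = c}) \ ⋃ c ∈ t, closedBall c (r c) with hU
  have mU : MeasurableSet U :=
    (hΩ.measurableSet.inter (isClosed_eq (Pk k).continuous continuous_id).measurableSet).diff
      (t.finite_toSet.isClosed_biUnion (fun _ _ => isClosed_closedBall)).measurableSet
  have mO : MeasurableSet (O \ A) := hO.measurableSet.diff hA
  have mK : MeasurableSet (K' \ Aᶜ) := hK'.measurableSet.diff hA.compl
  have mΩ : MeasurableSet (Ω \ W) := hΩ.measurableSet.diff hW
  set Z : Set (EE n) := ((fun x : EE n => x k.swap) ⁻¹' (O \ A) ∪ (fun x : EE n => x k.swap) ⁻¹' (K' \ Aᶜ)) ∪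
    ((fun x : EE n => Pk k x) ⁻¹' (Ω \ W) ∪ (fun x : EE n => Pk k x) ⁻¹' U) with hZ
  have mZ : MeasurableSet Z := ((mc mO).union (mc mK)).union ((mP mΩ).union (mP mU))
  have vZ : β Z ≤ δ := by
    rw [← hle]
    refine (measure_union_le _ _).trans (add_le_add ((measure_union_le _ _).trans (add_le_add ?_ ?_))
      ((measure_union_le _ _).trans (add_le_add ?_ ?_)))
    · rwa [hν, Measure.map_apply mc mO] at vO
    · rwa [hν, Measure.map_apply mc mK] at vK'
    · rwa [hμ, Measure.map_apply mP mΩ] at vΩ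
    · rwa [hμ, Measure.map_apply mP mU] at vt
  refine ⟨S, hS, s4, Z ∩ closedBall 0 R, mZ.inter measurableSet_closedBall, ?_, ?_⟩
  · rwa [hβ, Measure.restrict_apply mZ] at vZ
  · intro x hxR hxZ
    have hxZ : x ∉ Z := fun h => hxZ ⟨h, by simpa using hxR⟩
    rw [hZ] at hxZ
    simp only [mem_union, not_or, mem_preimage, mem_diff, not_and, not_not, mem_compl_iff] at hxZ
    obtain ⟨⟨z1, z2⟩, z3, z4⟩ := hxZ
    unfold _root_.shear
    by_cases hxΩ : Pk k x ∈ Ω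
    · have hxW := z3 hxΩ
      have hxB : Pk k x ∈ ⋃ c ∈ t, closedBall c (r c) := by
        by_contra hcon
        exact z4 ⟨⟨hxΩ, Pk_Pk k x⟩, hcon⟩
      rw [s1 x hxB, hFd]
      by_cases hxA : x k.swap ∈ A
      · have : x k.swap ∈ K'ᶜ := fun h => z2 h hxA
        simp [hxA, hxW, g1 _ this]
      · have : x k.swap ∈ Oᶜ := fun h => hxA (z1 h)
        simp [hxA, g0 _ this]
    · have : Pk k x ∉ W := fun h => hxΩ (hWΩ h)
      rw [s2 x hxΩ]
      simp [this]
end Shears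

section Grid

def cell {n : ℕ} (h : ℝ) (x : EE n) : (Fin n ⊕ Fin n) → ℤ := fun j => ⌊x j / h⌋

def Tperm {n : ℕ} (h : ℝ) (σ : Equiv.Perm ((Fin n ⊕ Fin n) → ℤ)) (x : EE n) : EE n :=
  WithLp.toLp 2 (fun j => x j + h * ((σ (cell h x) j : ℝ) - cell h x j))

lemma Tperm_apply {n : ℕ} (h : ℝ) (σ : Equiv.Perm ((Fin n ⊕ Fin n) → ℤ)) (x : EE n)
    (j : Fin n ⊕ Fin n) : Tperm h σ x j = x j + h * ((σ (cell h x) j : ℝ) - cell h x j) := rfl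

lemma cell_Tperm {n : ℕ} {h : ℝ} (hh : 0 < h) (σ : Equiv.Perm ((Fin n ⊕ Fin n) → ℤ)) (x : EE n) :
    cell h (Tperm h σ x) = σ (cell h x) := by
  funext j
  have : Tperm h σ x j / h = x j / h + ((σ (cell h x) j - cell h x j : ℤ) : ℝ) := by
    rw [Tperm_apply]; push_cast; field_simp
  show ⌊Tperm h σ x j / h⌋ = _
  rw [this, Int.floor_add_intCast]
  show cell h x j + _ = _
  ring

lemma Tperm_mul {n : ℕ} {h : ℝ} (hh : 0 < h) (σ τ : Equiv.Perm ((Fin n ⊕ Fin n) → ℤ)) :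
    (Tperm h (σ * τ) : EE n → EE n) = Tperm h σ ∘ Tperm h τ := by
  funext x
  ext j
  rw [Function.comp_apply, Tperm_apply, Tperm_apply h σ, cell_Tperm hh, Tperm_apply,
    Equiv.Perm.mul_apply]
  ring

lemma Tperm_one {n : ℕ} (h : ℝ) : (Tperm h 1 : EE n → EE n) = id := by
  funext x
  ext j
  simp [Tperm_apply]

def sX (r e : ℤ) (p : ℤ × ℤ) : ℤ × ℤ := (p.1 + if p.2 = r then e else 0, p.2)
def sY (c e : ℤ) (p : ℤ × ℤ) : ℤ × ℤ := (p.1, p.2 + if p.1 = c then e else 0)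
def sYP (p : ℤ × ℤ) : ℤ × ℤ := (p.1, p.2 + if p.1 = 0 ∨ p.1 = 1 then 1 else 0)

lemma word_eq (i j : ℤ) :
    sX 1 1 (sY 0 (-1) (sX 1 (-1) (sYP (sX 0 (-1) (sY 1 (-1) (sX 0 1 (i, j))))))) =
      (if (i = 0 ∨ i = 1) ∧ (j = 0 ∨ j = 1) then 1 - i else i, j) := by
  have hj : (j = 0 ∨ j = 1) ∨ j = 2 ∨ j = -1 ∨ (j ≠ 0 ∧ j ≠ 1 ∧ j ≠ 2 ∧ j ≠ -1) := by omega
  have hi : (i = 0 ∨ i = 1) ∨ i = -1 ∨ i = 2 ∨ (i ≠ 0 ∧ i ≠ 1 ∧ i ≠ 2 ∧ i ≠ -1) := by omega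
  simp only [sX, sY, sYP, Prod.mk.injEq]
  constructor <;> grind

def Tst {n : ℕ} (h : ℝ) (k : Fin n ⊕ Fin n) (x : EE n) (i0 j0 : ℤ) (p : ℤ × ℤ) : EE n :=
  x + (h * (p.1 - i0 : ℤ)) • ev k + (h / 2 * (p.2 - j0 : ℤ)) • ev k.swap

lemma Pk_swap {n : ℕ} (k : Fin n ⊕ Fin n) : (Pk k.swap : EE n →L[ℝ] EE n) = Pk k := by
  ext u j
  rw [Pk_apply, Pk_apply, Sum.swap_swap]
  simp only [or_comm]

lemma Tst_Pk {n : ℕ} (h : ℝ) (k : Fin n ⊕ Fin n) (x : EE n) (i0 j0 : ℤ) (p : ℤ × ℤ) :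
    Pk k (Tst h k x i0 j0 p) = Pk k x := by
  have : Pk k (ev k.swap : EE n) = 0 := by rw [← Pk_swap, Pk_ev]
  simp only [Tst, map_add, map_smul, Pk_ev, this, smul_zero, add_zero]

lemma Tst_k {n : ℕ} (h : ℝ) (k : Fin n ⊕ Fin n) (x : EE n) (i0 j0 : ℤ) (p : ℤ × ℤ) :
    Tst h k x i0 j0 p k = x k + h * (p.1 - i0 : ℤ) := by
  simp [Tst, ev_apply, (swap_ne k).symm]

lemma Tst_swap {n : ℕ} (h : ℝ) (k : Fin n ⊕ Fin n) (x : EE n) (i0 j0 : ℤ) (p : ℤ × ℤ) :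
    Tst h k x i0 j0 p k.swap = x k.swap + h / 2 * (p.2 - j0 : ℤ) := by
  simp [Tst, ev_apply, swap_ne k]

lemma Tst_row {n : ℕ} {h : ℝ} (hh : 0 < h) (k : Fin n ⊕ Fin n) (x : EE n) (i0 j0 b : ℤ)
    (hb : ⌊2 * x k.swap / h⌋ - b = j0) (p : ℤ × ℤ) :
    ⌊2 * Tst h k x i0 j0 p k.swap / h⌋ - b = p.2 := by
  have : 2 * Tst h k x i0 j0 p k.swap / h = 2 * x k.swap / h + (p.2 - j0 : ℤ) := by
    rw [Tst_swap]; field_simp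
  rw [this, Int.floor_add_intCast]; omega

lemma Tst_col {n : ℕ} {h : ℝ} (hh : 0 < h) (k : Fin n ⊕ Fin n) (x : EE n) (i0 j0 b : ℤ)
    (hb : ⌊x k / h⌋ - b = i0) (p : ℤ × ℤ) :
    ⌊Tst h k x i0 j0 p k / h⌋ - b = p.1 := by
  have : Tst h k x i0 j0 p k / h = x k / h + (p.1 - i0 : ℤ) := by
    rw [Tst_k]; field_simp
  rw [this, Int.floor_add_intCast]; omega

def SX {n : ℕ} (h : ℝ) (k : Fin n ⊕ Fin n) (b : ℤ) (W : Set (EE n)) (r e : ℤ) : EE n → EE n :=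
  shear k (h * e) {t | ⌊2 * t / h⌋ - b = r} W
def SY {n : ℕ} (h : ℝ) (k : Fin n ⊕ Fin n) (b : ℤ) (W : Set (EE n)) (c e : ℤ) : EE n → EE n :=
  shear k.swap (h / 2 * e) {t | ⌊t / h⌋ - b = c} W
def SYP {n : ℕ} (h : ℝ) (k : Fin n ⊕ Fin n) (b : ℤ) (W : Set (EE n)) : EE n → EE n :=
  shear k.swap (h / 2) {t | ⌊t / h⌋ - b = 0 ∨ ⌊t / h⌋ - b = 1} W

lemma SX_Tst {n : ℕ} {h : ℝ} (hh : 0 < h) (k : Fin n ⊕ Fin n) (x : EE n) (i0 j0 b : ℤ)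
    (hb : ⌊2 * x k.swap / h⌋ - b = j0) (W : Set (EE n)) (hW : Pk k x ∈ W) (r e : ℤ) (p : ℤ × ℤ) :
    SX h k b W r e (Tst h k x i0 j0 p) = Tst h k x i0 j0 (sX r e p) := by
  unfold SX shear
  rw [Tst_Pk]
  simp only [hW, and_true, Set.mem_setOf_eq, Tst_row hh k x i0 j0 b hb]
  unfold sX Tst
  split_ifs
  · simp only [Int.cast_sub, Int.cast_add]; module
  · simp

lemma SY_Tst {n : ℕ} {h : ℝ} (hh : 0 < h) (k : Fin n ⊕ Fin n) (x : EE n) (i0 j0 b : ℤ)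
    (hb : ⌊x k / h⌋ - b = i0) (W : Set (EE n)) (hW : Pk k x ∈ W) (r e : ℤ) (p : ℤ × ℤ) :
    SY h k b W r e (Tst h k x i0 j0 p) = Tst h k x i0 j0 (sY r e p) := by
  unfold SY shear
  rw [Pk_swap, Tst_Pk]
  simp only [hW, and_true, Set.mem_setOf_eq, Tst_col hh k x i0 j0 b hb, Sum.swap_swap]
  unfold sY Tst
  split_ifs
  · simp only [Int.cast_sub, Int.cast_add]; module
  · simp

lemma SYP_Tst {n : ℕ} {h : ℝ} (hh : 0 < h) (k : Fin n ⊕ Fin n) (x : EE n) (i0 j0 b : ℤ)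
    (hb : ⌊x k / h⌋ - b = i0) (W : Set (EE n)) (hW : Pk k x ∈ W) (p : ℤ × ℤ) :
    SYP h k b W (Tst h k x i0 j0 p) = Tst h k x i0 j0 (sYP p) := by
  unfold SYP shear
  rw [Pk_swap, Tst_Pk]
  simp only [hW, and_true, Set.mem_setOf_eq, Tst_col hh k x i0 j0 b hb, Sum.swap_swap]
  unfold sYP Tst
  split_ifs
  · simp only [Int.cast_sub, Int.cast_add, Int.cast_one]; module
  · simp

lemma SX_out {n : ℕ} (h : ℝ) (k : Fin n ⊕ Fin n) (x : EE n) (b : ℤ)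
    (W : Set (EE n)) (hW : Pk k x ∉ W) (r e : ℤ) : SX h k b W r e x = x := by
  simp [SX, shear, hW]

lemma SY_out {n : ℕ} (h : ℝ) (k : Fin n ⊕ Fin n) (x : EE n) (b : ℤ)
    (W : Set (EE n)) (hW : Pk k x ∉ W) (r e : ℤ) : SY h k b W r e x = x := by
  simp [SY, shear, hW, Pk_swap]

lemma SYP_out {n : ℕ} (h : ℝ) (k : Fin n ⊕ Fin n) (x : EE n) (b : ℤ)
    (W : Set (EE n)) (hW : Pk k x ∉ W) : SYP h k b W x = x := by
  simp [SYP, shear, hW, Pk_swap]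

lemma meas_floor (c h : ℝ) (b r : ℤ) : MeasurableSet {t : ℝ | ⌊c * t / h⌋ - b = r} := by
  have : Measurable (fun t : ℝ => ⌊c * t / h⌋ - b) :=
    (measurable_of_countable (fun z : ℤ => z - b)).comp
      (Int.measurable_floor.comp (by fun_prop))
  exact this (measurableSet_singleton r)

lemma meas_floor1 (h : ℝ) (b r : ℤ) : MeasurableSet {t : ℝ | ⌊t / h⌋ - b = r} := by
  simpa using meas_floor 1 h b r

lemma half_floor {h : ℝ} (hh : 0 < h) (t : ℝ) (a : ℤ) :
    (⌊2 * t / h⌋ - 2 * a = 0 ∨ ⌊2 * t / h⌋ - 2 * a = 1) ↔ ⌊t / h⌋ = a := by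
  have e : 2 * t / h = 2 * (t / h) := by ring
  rw [e]
  set u := t / h
  have h1 := Int.floor_le u
  have h2 := Int.lt_floor_add_one u
  have h3 := Int.floor_le (2 * u)
  have h4 := Int.lt_floor_add_one (2 * u)
  have l1 : 2 * ⌊u⌋ ≤ ⌊2 * u⌋ := by rw [Int.le_floor]; push_cast; linarith
  have l2 : ⌊2 * u⌋ < 2 * ⌊u⌋ + 2 := by rw [Int.floor_lt]; push_cast; linarith
  omega

lemma Appr.adj {n : ℕ} {h : ℝ} (hh : 0 < h) (k : Fin n ⊕ Fin n) (a : (Fin n ⊕ Fin n) → ℤ) :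
    Appr (Tperm h (Equiv.swap a (a + Pi.single k 1)) : EE n → EE n) := by
  set W : Set (EE n) := {w | ∀ j, j ≠ k → j ≠ k.swap → ⌊w j / h⌋ = a j} with hWd
  have mW : MeasurableSet W := by
    have : W = ⋂ j : Fin n ⊕ Fin n, {w | j ≠ k → j ≠ k.swap → ⌊w j / h⌋ = a j} := by
      ext w; simp [hWd]
    rw [this]
    refine MeasurableSet.iInter fun j => ?_
    by_cases h1 : j = k
    · simp [h1]
    by_cases h2 : j = k.swap
    · simp [h2]
    have m : Measurable (fun w : EE n => ⌊w j / h⌋) := Int.measurable_floor.comp (by fun_prop)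
    have := m (measurableSet_singleton (a j))
    simpa [h1, h2, Set.preimage] using this
  have aX : ∀ r e, Appr (SX h k (2 * a k.swap) W r e) := fun r e =>
    Appr.shear k _ _ (meas_floor 2 h _ r) W mW
  have aY : ∀ r e, Appr (SY h k (a k) W r e) := fun r e =>
    Appr.shear k.swap _ _ (meas_floor1 h _ r) W mW
  have aYP : Appr (SYP h k (a k) W) :=
    Appr.shear k.swap _ _ ((meas_floor1 h _ 0).union (meas_floor1 h _ 1)) W mW
  have key := (aX 1 1).comp ((aY 0 (-1)).comp ((aX 1 (-1)).comp (aYP.comp ((aX 0 (-1)).comp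
    ((aY 1 (-1)).comp (aX 0 1))))))
  convert key using 1
  funext x
  simp only [Function.comp_apply]
  by_cases hx : Pk k x ∈ W
  · set i0 := ⌊x k / h⌋ - a k with hi0
    set j0 := ⌊2 * x k.swap / h⌋ - 2 * a k.swap with hj0
    have hx0 : x = Tst h k x i0 j0 (i0, j0) := by simp [Tst]
    have hs := fun r e p => SX_Tst hh k x i0 j0 (2 * a k.swap) hj0.symm W hx r e p
    have ht := fun r e p => SY_Tst hh k x i0 j0 (a k) hi0.symm W hx r e p
    have hu := fun p => SYP_Tst hh k x i0 j0 (a k) hi0.symm W hx p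
    conv_rhs => rw [hx0]
    rw [hs, ht, hs, hu, hs, ht, hs, word_eq]
    have hw : ∀ j, j ≠ k → j ≠ k.swap → cell h x j = a j := by
      intro j h1 h2
      have := hx j h1 h2
      rw [Pk_apply, if_neg (by tauto)] at this
      exact this
    have hf := half_floor hh (x k.swap) (a k.swap)
    rw [← hj0] at hf
    have hck : cell h x k = i0 + a k := by simp [cell, hi0]
    have hcs : cell h x k.swap = ⌊x k.swap / h⌋ := rfl
    have heq : ∀ c, cell h x = c ↔ (∀ j, j ≠ k → j ≠ k.swap → a j = c j) ∧ i0 + a k = c k ∧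
        ⌊x k.swap / h⌋ = c k.swap := by
      intro c
      constructor
      · rintro rfl
        exact ⟨fun j h1 h2 => (hw j h1 h2).symm, hck.symm, hcs.symm⟩
      · rintro ⟨h1, h2, h3⟩
        funext j
        by_cases e1 : j = k
        · rw [e1, hck, h2]
        by_cases e2 : j = k.swap
        · rw [e2, hcs, h3]
        rw [hw j e1 e2, h1 j e1 e2]
    have ca : cell h x = a ↔ i0 = 0 ∧ (j0 = 0 ∨ j0 = 1) := by
      rw [heq, hf]
      constructor
      · rintro ⟨_, h2, h3⟩; exact ⟨by omega, h3⟩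
      · rintro ⟨h2, h3⟩; exact ⟨fun _ _ _ => rfl, by omega, h3⟩
    have cb : cell h x = a + Pi.single k 1 ↔ i0 = 1 ∧ (j0 = 0 ∨ j0 = 1) := by
      rw [heq, hf]
      simp only [Pi.add_apply, Pi.single_eq_same, Pi.single_eq_of_ne (swap_ne k), add_zero]
      constructor
      · rintro ⟨_, h2, h3⟩; exact ⟨by omega, h3⟩
      · rintro ⟨h2, h3⟩; exact ⟨fun j h1 _ => by simp [h1], by omega, h3⟩
    ext j
    rw [Tperm_apply]
    by_cases c1 : cell h x = a
    · have c1' := ca.1 c1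
      rw [c1, Equiv.swap_apply_left, if_pos ⟨Or.inl c1'.1, c1'.2⟩, c1'.1]
      by_cases e : j = k
      · subst e; simp [Tst, ev_apply, (swap_ne _).symm]
      · simp [Tst, ev_apply, e]
    by_cases c2 : cell h x = a + Pi.single k 1
    · have c1' := cb.1 c2
      rw [c2, Equiv.swap_apply_right, if_pos ⟨Or.inr c1'.1, c1'.2⟩, c1'.1]
      by_cases e : j = k
      · subst e; simp [Tst, ev_apply, (swap_ne _).symm]
      · simp [Tst, ev_apply, e]
    · rw [Equiv.swap_apply_of_ne_of_ne c1 c2, if_neg (by tauto)]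
      simp [Tst]
  · simp only [SX_out h k x _ W hx, SY_out h k x _ W hx, SYP_out h k x _ W hx]
    have c1 : cell h x ≠ a := by
      intro e
      apply hx
      intro j h1 h2
      rw [Pk_apply, if_neg (by tauto), ← e]; rfl
    have c2 : cell h x ≠ a + Pi.single k 1 := by
      intro e
      apply hx
      intro j h1 h2
      rw [Pk_apply, if_neg (by tauto)]
      have : cell h x j = a j := by rw [e]; simp [h1]
      exact this
    ext j
    rw [Tperm_apply, Equiv.swap_apply_of_ne_of_ne c1 c2]
    ring

def Sw {n : ℕ} (h : ℝ) (a b : (Fin n ⊕ Fin n) → ℤ) : Prop :=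
  Appr (Tperm h (Equiv.swap a b) : EE n → EE n)

lemma Sw.refl {n : ℕ} (h : ℝ) (a : (Fin n ⊕ Fin n) → ℤ) : Sw h a a := by
  unfold Sw
  rw [Equiv.swap_self]
  have := Tperm_one (n := n) h
  have e : (Tperm h (Equiv.refl _) : EE n → EE n) = id := this
  rw [e]; exact Appr.id

lemma Sw.symm {n : ℕ} {h : ℝ} {a b : (Fin n ⊕ Fin n) → ℤ} (H : Sw h a b) : Sw h b a := by
  unfold Sw at *
  rwa [Equiv.swap_comm]

lemma Sw.trans {n : ℕ} {h : ℝ} (hh : 0 < h) {a b c : (Fin n ⊕ Fin n) → ℤ} (H : Sw h a b)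
    (K : Sw h b c) : Sw h a c := by
  by_cases e1 : a = b
  · subst e1; exact K
  by_cases e2 : a = c
  · subst e2; exact Sw.refl h a
  by_cases e3 : b = c
  · subst e3; exact H
  have : Equiv.swap a c = Equiv.swap a b * Equiv.swap b c * Equiv.swap a b := by
    rw [Equiv.swap_comm a b, Equiv.swap_comm b c, Equiv.swap_mul_swap_mul_swap] <;> tauto
  unfold Sw at *
  rw [this, Tperm_mul hh, Tperm_mul hh]
  exact (H.comp K).comp H

lemma Sw.single {n : ℕ} {h : ℝ} (hh : 0 < h) (k : Fin n ⊕ Fin n) (a : (Fin n ⊕ Fin n) → ℤ)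
    (z : ℤ) : Sw h a (a + Pi.single k z) := by
  induction z using Int.induction_on with
  | zero => simpa using Sw.refl h a
  | succ i ih =>
    have := Appr.adj hh k (a + Pi.single k (i : ℤ))
    rw [add_assoc, ← Pi.single_add] at this
    exact ih.trans hh this
  | pred i ih =>
    have := Appr.adj hh k (a + Pi.single k (-(i : ℤ) - 1))
    rw [add_assoc, ← Pi.single_add, sub_add_cancel] at this
    exact ih.trans hh (Sw.symm this)

lemma Sw.all {n : ℕ} {h : ℝ} (hh : 0 < h) (a b : (Fin n ⊕ Fin n) → ℤ) : Sw h a b := by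
  have : ∀ s : Finset (Fin n ⊕ Fin n), Sw h a (a + ∑ k ∈ s, Pi.single k (b k - a k)) := by
    intro s
    induction s using Finset.induction_on with
    | empty => simpa using Sw.refl h a
    | insert k s hk ih =>
      rw [Finset.sum_insert hk, add_comm (Pi.single _ _), ← add_assoc]
      exact ih.trans hh (Sw.single hh k _ _)
  have h2 := this Finset.univ
  rwa [Finset.univ_sum_single (f := fun k => b k - a k),
    show (a + fun k => b k - a k) = b by funext k; simp] at h2

lemma Appr.perm {n : ℕ} {h : ℝ} (hh : 0 < h) (F : Finset ((Fin n ⊕ Fin n) → ℤ))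
    (σ : Equiv.Perm {x // x ∈ F}) :
    Appr (Tperm h (Equiv.Perm.ofSubtype σ) : EE n → EE n) := by
  induction σ using Equiv.Perm.swap_induction_on with
  | one => rw [map_one, Tperm_one]; exact Appr.id
  | swap_mul f x y hxy ih =>
    rw [map_mul, Tperm_mul hh, Equiv.Perm.ofSubtype_swap_eq]
    exact Appr.comp (Sw.all hh _ _) ih

end Grid

section Birk

lemma birk_perm {ι : Type*} [Fintype ι] [DecidableEq ι] (D C : ι → ι → ℝ)
    (h0 : ∀ i j, 0 ≤ D i j) (hr : ∀ i, ∑ j, D i j = 1) (hc : ∀ j, ∑ i, D i j = 1) :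
    ∃ σ : Equiv.Perm ι, ∑ i, C i (σ i) ≤ ∑ i, ∑ j, D i j * C i j := by
  have hD : (Matrix.of D) ∈ doublyStochastic ℝ ι :=
    mem_doublyStochastic_iff_sum.2 ⟨h0, hr, hc⟩
  obtain ⟨w, w0, w1, hw⟩ := exists_eq_sum_perm_of_mem_doublyStochastic hD
  by_contra! hcon
  have hDij : ∀ i j, D i j = ∑ σ : Equiv.Perm ι, w σ * (if σ i = j then 1 else 0) := by
    intro i j
    have := congrFun (congrFun hw i) j
    rw [Matrix.of_apply] at this
    rw [← this, Matrix.sum_apply]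
    refine Finset.sum_congr rfl fun σ _ => ?_
    rw [Matrix.smul_apply, smul_eq_mul]
    congr 1
    simp [Equiv.Perm.permMatrix, PEquiv.toMatrix_apply, eq_comm]
  have e : ∑ i, ∑ j, D i j * C i j = ∑ σ : Equiv.Perm ι, w σ * ∑ i, C i (σ i) := by
    calc ∑ i, ∑ j, D i j * C i j
        = ∑ i, ∑ j, ∑ σ : Equiv.Perm ι, w σ * (if σ i = j then C i j else 0) := by
          refine Finset.sum_congr rfl fun i _ => Finset.sum_congr rfl fun j _ => ?_
          rw [hDij, Finset.sum_mul]
          refine Finset.sum_congr rfl fun σ _ => ?_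
          split_ifs <;> simp
      _ = ∑ i, ∑ σ : Equiv.Perm ι, w σ * C i (σ i) := by
          refine Finset.sum_congr rfl fun i _ => ?_
          rw [Finset.sum_comm]
          refine Finset.sum_congr rfl fun σ _ => ?_
          rw [← Finset.mul_sum]
          simp
      _ = _ := by
          rw [Finset.sum_comm]
          refine Finset.sum_congr rfl fun σ _ => ?_
          rw [Finset.mul_sum]
  set A := ∑ i, ∑ j, D i j * C i j with hA
  have h1 : ∑ σ : Equiv.Perm ι, w σ * A < ∑ σ : Equiv.Perm ι, w σ * ∑ i, C i (σ i) := by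
    refine Finset.sum_lt_sum (fun σ _ => mul_le_mul_of_nonneg_left (hcon σ).le (w0 σ)) ?_
    by_contra! hh
    have : ∀ σ, w σ = 0 := by
      intro σ
      by_contra hne
      have := hh σ (Finset.mem_univ _)
      have hp : 0 < w σ := lt_of_le_of_ne (w0 σ) (Ne.symm hne)
      have := mul_lt_mul_of_pos_left (hcon σ) hp
      linarith
    simp [this] at w1
  rw [← Finset.sum_mul, w1, one_mul, ← e] at h1
  exact lt_irrefl _ h1

lemma birk {ι : Type*} [Fintype ι] [DecidableEq ι] (m C : ι → ι → ℝ) (v : ℝ) (hv : 0 < v)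
    (h0 : ∀ i j, 0 ≤ m i j) (hr : ∀ i, ∑ j, m i j ≤ v) (hc : ∀ j, ∑ i, m i j ≤ v)
    (hg : ∀ i, ∑ j, m i j = v ∨ ∀ j, C i j = 0) :
    ∃ σ : Equiv.Perm ι, v * ∑ i, C i (σ i) ≤ ∑ i, ∑ j, m i j * C i j := by
  set a : ι → ℝ := fun i => v - ∑ j, m i j with ha
  set b : ι → ℝ := fun j => v - ∑ i, m i j with hb
  have a0 : ∀ i, 0 ≤ a i := fun i => sub_nonneg.2 (hr i)
  have b0 : ∀ i, 0 ≤ b i := fun i => sub_nonneg.2 (hc i)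
  set t := ∑ i, a i with ht
  have htb : ∑ j, b j = t := by
    simp only [ht, ha, hb, Finset.sum_sub_distrib]
    rw [Finset.sum_comm]
  have t0 : 0 ≤ t := Finset.sum_nonneg fun i _ => a0 i
  have az : ∀ i, a i * (t / t) = a i := by
    intro i
    by_cases h : t = 0
    · have := (Finset.sum_eq_zero_iff_of_nonneg (fun i _ => a0 i)).1 h i (Finset.mem_univ _)
      rw [this, zero_mul]
    · rw [div_self h, mul_one]
  have bz : ∀ i, b i * (t / t) = b i := by
    intro i
    by_cases h : t = 0
    · rw [← htb] at h
      have := (Finset.sum_eq_zero_iff_of_nonneg (fun i _ => b0 i)).1 h i (Finset.mem_univ _)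
      rw [this, zero_mul]
    · rw [div_self h, mul_one]
  obtain ⟨σ, hσ⟩ := birk_perm (fun i j => (m i j + a i * b j / t) / v) C
    (fun i j => div_nonneg (add_nonneg (h0 i j)
      (div_nonneg (mul_nonneg (a0 i) (b0 j)) t0)) hv.le)
    (fun i => by
      rw [← Finset.sum_div, Finset.sum_add_distrib, ← Finset.sum_div, ← Finset.mul_sum, htb,
        mul_div_assoc, az, ha]
      simp [hv.ne'])
    (fun j => by
      rw [← Finset.sum_div, Finset.sum_add_distrib, ← Finset.sum_div, ← Finset.sum_mul, ← ht,
        mul_comm t, mul_div_assoc, bz, hb]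
      simp [hv.ne'])
  refine ⟨σ, ?_⟩
  have e : ∑ i, ∑ j, (m i j + a i * b j / t) / v * C i j = (∑ i, ∑ j, m i j * C i j) / v := by
    rw [Finset.sum_div]
    refine Finset.sum_congr rfl fun i _ => ?_
    rw [Finset.sum_div]
    refine Finset.sum_congr rfl fun j _ => ?_
    rcases hg i with h | h
    · have : a i = 0 := by simp [ha, h]
      rw [this]; ring
    · rw [h j]; ring
  rw [e, le_div_iff₀ hv] at hσ
  linarith

lemma int_fin {X κ : Type*} [MeasurableSpace X] [MeasurableSpace κ] [MeasurableSingletonClass κ]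
    (μ : Measure X) [IsFiniteMeasure μ] (c : X → κ) (hc : Measurable c)
    (F : Finset κ) (hF : ∀ᵐ x ∂μ, c x ∈ F) (f : κ → ℝ) :
    ∫ x, f (c x) ∂μ = ∑ i ∈ F, μ.real (c ⁻¹' {i}) * f i ∧ Integrable (fun x => f (c x)) μ := by
  classical
  have e : (fun x => f (c x)) =ᵐ[μ] fun x => ∑ i ∈ F, (c ⁻¹' {i}).indicator (fun _ => f i) x := by
    filter_upwards [hF] with x hx
    rw [Finset.sum_eq_single (c x)]
    · simp
    · intro b _ hb
      rw [Set.indicator_of_notMem]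
      simpa using Ne.symm hb
    · exact fun h => absurd hx h
  have hi : ∀ i, Integrable ((c ⁻¹' {i}).indicator (fun _ => f i)) μ := fun i =>
    (integrable_const _).indicator (hc (measurableSet_singleton i))
  constructor
  · rw [integral_congr_ae e, integral_finsetSum _ (fun i _ => hi i)]
    refine Finset.sum_congr rfl fun i _ => ?_
    rw [integral_indicator_const _ (hc (measurableSet_singleton i)), smul_eq_mul]
  · exact (integrable_finsetSum _ (fun i _ => hi i)).congr e.symm

lemma cell_meas {n : ℕ} (h : ℝ) : Measurable (cell h : EE n → _) :=
  measurable_pi_lambda _ fun j => Int.measurable_floor.comp (by fun_prop)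

lemma cell_iff {n : ℕ} {h : ℝ} (hh : 0 < h) (x : EE n) (c : (Fin n ⊕ Fin n) → ℤ) :
    cell h x = c ↔ ∀ j, h * c j ≤ x j ∧ x j < h * c j + h := by
  rw [funext_iff]
  refine forall_congr' fun j => ?_
  show ⌊x j / h⌋ = c j ↔ _
  rw [Int.floor_eq_iff, le_div_iff₀ hh, div_lt_iff₀ hh]
  constructor <;> rintro ⟨h1, h2⟩ <;> constructor <;> linarith

lemma cell_vol {n : ℕ} {h : ℝ} (hh : 0 < h) (c : (Fin n ⊕ Fin n) → ℤ) :
    volume ((cell h : EE n → _) ⁻¹' {c}) = ENNReal.ofReal (h ^ Fintype.card (Fin n ⊕ Fin n)) := by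
  have e : ((cell h : EE n → _) ⁻¹' {c}) = (WithLp.ofLp : EE n → _) ⁻¹'
      (Set.pi univ fun j => Ico (h * c j) (h * c j + h)) := by
    ext x
    simp only [mem_preimage, mem_singleton_iff, cell_iff hh, Set.mem_pi, mem_univ, true_imp_iff,
      mem_Ico]
  rw [e, (PiLp.volume_preserving_ofLp (Fin n ⊕ Fin n)).measure_preimage
    (MeasurableSet.univ_pi fun j => measurableSet_Ico).nullMeasurableSet, Real.volume_pi_Ico]
  simp only [add_sub_cancel_left, Finset.prod_const, Finset.card_univ]
  rw [ENNReal.ofReal_pow hh.le]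

def Lc (n : ℕ) : ℝ := √(Fintype.card (Fin n ⊕ Fin n))

lemma Lc_nonneg (n : ℕ) : 0 ≤ Lc n := Real.sqrt_nonneg _

lemma norm_le_Lc {n : ℕ} (x : EE n) (B : ℝ) (hB : 0 ≤ B) (h : ∀ j, |x j| ≤ B) : ‖x‖ ≤ Lc n * B := by
  rw [EuclideanSpace.norm_eq]
  have : ∑ i, ‖x i‖ ^ 2 ≤ (Fintype.card (Fin n ⊕ Fin n)) * B ^ 2 := by
    have := Finset.sum_le_card_nsmul Finset.univ (fun i => ‖x i‖ ^ 2) (B ^ 2)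
      (fun i _ => by rw [Real.norm_eq_abs]; exact pow_le_pow_left₀ (abs_nonneg _) (h i) 2)
    simpa [Finset.card_univ] using this
  refine (Real.sqrt_le_sqrt this).trans ?_
  rw [Real.sqrt_mul (by positivity), Real.sqrt_sq hB, Lc]

def yc {n : ℕ} (h : ℝ) (c : (Fin n ⊕ Fin n) → ℤ) : EE n := WithLp.toLp 2 fun j => h * c j

lemma yc_near {n : ℕ} {h : ℝ} (hh : 0 < h) (x : EE n) : ‖x - yc h (cell h x)‖ ≤ Lc n * h := by
  refine norm_le_Lc _ _ hh.le fun j => ?_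
  have := (cell_iff hh x _).1 rfl j
  show |x j - h * cell h x j| ≤ h
  rw [abs_le]; constructor <;> linarith

lemma cell_near {n : ℕ} {h : ℝ} (hh : 0 < h) (x y : EE n) (e : cell h x = cell h y) :
    ‖x - y‖ ≤ Lc n * h := by
  refine norm_le_Lc _ _ hh.le fun j => ?_
  have h1 := (cell_iff hh x _).1 rfl j
  have h2 := (cell_iff hh y _).1 rfl j
  rw [e] at h1
  show |x j - y j| ≤ h
  rw [abs_le]; constructor <;> linarith

lemma Tperm_meas {n : ℕ} (h : ℝ) (σ : Equiv.Perm ((Fin n ⊕ Fin n) → ℤ)) :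
    Measurable (Tperm h σ : EE n → EE n) := by
  let f : ((Fin n ⊕ Fin n) → ℤ) → EE n := fun c => WithLp.toLp 2 (fun j => h * ((σ c j : ℝ) - c j))
  have hf : Measurable f := measurable_of_countable f
  have : (Tperm h σ : EE n → EE n) = fun x => x + f (cell h x) := by
    funext x; ext j; simp [Tperm_apply, f]
  rw [this]
  exact measurable_id.add (hf.comp (cell_meas h))

end Birk

section Main

lemma bdd_int {n : ℕ} {U : Set (EE n)} (hU : MeasurableSet U) (hf : volume U ≠ ⊤)
    (f : EE n → ℝ) (hm : Measurable f) (C : ℝ) (hC : ∀ x ∈ U, |f x| ≤ C) :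
    Integrable f (volume.restrict U) := by
  have : IsFiniteMeasure (volume.restrict U) := ⟨by simpa using hf.lt_top⟩
  exact Integrable.of_bound hm.aestronglyMeasurable C
    ((ae_restrict_iff' hU).2 (Filter.Eventually.of_forall fun x hx => by simpa using hC x hx))

lemma grid_perm {n : ℕ} {U : Set (EE n)} (hUm : MeasurableSet U) (hUf : volume U ≠ ⊤)
    (s : EE n → EE n) (hs : Measurable s) (B : Set (EE n))
    (hmp : Measure.map s (volume.restrict U) = volume.restrict B) {h : ℝ} (hh : 0 < h)
    (F : Finset ((Fin n ⊕ Fin n) → ℤ)) (hF1 : ∀ x ∈ U, cell h x ∈ F)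
    (hF2 : ∀ x ∈ U, cell h (s x) ∈ F)
    (C : ((Fin n ⊕ Fin n) → ℤ) → ((Fin n ⊕ Fin n) → ℤ) → ℝ) (hC0 : ∀ i j, 0 ≤ C i j)
    (hC : ∀ i, (cell h ⁻¹' {i} : Set (EE n)) ⊆ U ∨ ∀ j, C i j = 0) :
    ∃ σ : Equiv.Perm {x // x ∈ F},
      ∫ x in U, C (cell h x) (Equiv.Perm.ofSubtype σ (cell h x)) ≤
        ∫ x in U, C (cell h x) (cell h (s x)) ∧
      Integrable (fun x => C (cell h x) (Equiv.Perm.ofSubtype σ (cell h x))) (volume.restrict U) ∧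
      Integrable (fun x => C (cell h x) (cell h (s x))) (volume.restrict U) := by
  classical
  have : IsFiniteMeasure (volume.restrict U) := ⟨by simpa using hUf.lt_top⟩
  set μ := (volume.restrict U : Measure (EE n)) with hμ
  have hcm := cell_meas (n := n) h
  have hcs : Measurable (fun x => cell h (s x)) := hcm.comp hs
  have ae1 : ∀ᵐ x ∂μ, cell h x ∈ F :=
    (ae_restrict_iff' hUm).2 (Filter.Eventually.of_forall hF1)
  have ae2 : ∀ᵐ x ∂μ, cell h (s x) ∈ F :=
    (ae_restrict_iff' hUm).2 (Filter.Eventually.of_forall hF2)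
  set v : ℝ := h ^ Fintype.card (Fin n ⊕ Fin n) with hv
  have v0 : 0 < v := by positivity
  set A : ((Fin n ⊕ Fin n) → ℤ) → Set (EE n) := fun i => cell h ⁻¹' {i} with hA
  set A' : ((Fin n ⊕ Fin n) → ℤ) → Set (EE n) := fun j => (fun x => cell h (s x)) ⁻¹' {j} with hA'
  have mA : ∀ i, MeasurableSet (A i) := fun i => hcm (measurableSet_singleton i)
  have mA' : ∀ i, MeasurableSet (A' i) := fun i => hcs (measurableSet_singleton i)
  set c2 : EE n → ((Fin n ⊕ Fin n) → ℤ) × ((Fin n ⊕ Fin n) → ℤ) :=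
    fun x => (cell h x, cell h (s x)) with hc2
  have mc2 : Measurable c2 := hcm.prodMk hcs
  have ec2 : ∀ i j, c2 ⁻¹' {(i, j)} = A i ∩ A' j := by
    intro i j; ext x; simp [hc2, hA, hA', Prod.ext_iff]
  set m : {x // x ∈ F} → {x // x ∈ F} → ℝ := fun i j => μ.real (A i ∩ A' j) with hm
  have volA : ∀ i, (volume : Measure (EE n)).real (A i) = v := by
    intro i
    rw [measureReal_def, hA, cell_vol hh, ENNReal.toReal_ofReal v0.le]
  have volA' : ∀ i, (volume : Measure (EE n)) (A i) ≠ ⊤ := by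
    intro i
    rw [hA, cell_vol hh]; exact ENNReal.ofReal_ne_top
  have rowle : ∀ i, μ.real (A i) ≤ v := by
    intro i
    rw [← volA i]
    exact ENNReal.toReal_mono (volA' i) (Measure.restrict_apply_le _ _)
  have rowsum : ∀ i : {x // x ∈ F}, ∑ j, m i j = μ.real (A i) := by
    intro i
    have h1 := (int_fin (μ.restrict (A i)) (fun x => cell h (s x)) hcs F
      (ae_restrict_of_ae ae2) (fun _ => 1)).1
    have h2 : ∫ x, (1 : ℝ) ∂(μ.restrict (A i)) = μ.real (A i) := by
      simp
    rw [h2] at h1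
    rw [h1, ← Finset.sum_coe_sort F]
    refine Finset.sum_congr rfl fun j _ => ?_
    rw [mul_one, measureReal_restrict_apply (mA' j), inter_comm]
  have colsum : ∀ j : {x // x ∈ F}, ∑ i, m i j = μ.real (A' j) := by
    intro j
    have h1 := (int_fin (μ.restrict (A' j)) (fun x => cell h x) hcm F
      (ae_restrict_of_ae ae1) (fun _ => 1)).1
    have h2 : ∫ x, (1 : ℝ) ∂(μ.restrict (A' j)) = μ.real (A' j) := by
      simp
    rw [h2] at h1
    rw [h1, ← Finset.sum_coe_sort F]
    refine Finset.sum_congr rfl fun i _ => ?_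
    rw [mul_one, measureReal_restrict_apply (mA i)]
  have colle : ∀ j, μ.real (A' j) ≤ v := by
    intro j
    have : μ (A' j) = (volume.restrict B) (A j) := by
      rw [← hmp, Measure.map_apply hs (mA j)]; rfl
    rw [← volA j, measureReal_def, this]
    exact ENNReal.toReal_mono (volA' j) (Measure.restrict_apply_le _ _)
  obtain ⟨σ, hσ⟩ := birk m (fun i j => C i j) v v0 (fun i j => measureReal_nonneg)
    (fun i => by rw [rowsum]; exact rowle i) (fun j => by rw [colsum]; exact colle j)
    (fun i => by
      rcases hC i with h1 | h1
      · left
        rw [rowsum, ← volA i, measureReal_def, hμ, Measure.restrict_apply (mA i),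
          inter_eq_left.2 h1]; rfl
      · right; intro j; exact h1 j)
  obtain ⟨e1, i1⟩ := int_fin μ (fun x => cell h x) hcm F ae1
    (fun c => C c (Equiv.Perm.ofSubtype σ c))
  obtain ⟨e2, i2⟩ := int_fin μ c2 mc2 (F ×ˢ F)
    (by filter_upwards [ae1, ae2] with x h1 h2 using Finset.mem_product.2 ⟨h1, h2⟩)
    (fun c => C c.1 c.2)
  refine ⟨σ, ?_, i1, i2⟩
  have e2' : ∫ x, C (cell h x) (cell h (s x)) ∂μ = _ := e2
  rw [e1, e2', Finset.sum_product, ← Finset.sum_coe_sort F, ← Finset.sum_coe_sort F]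
  calc _ ≤ ∑ i : {x // x ∈ F}, v * C i (σ i) := by
        refine Finset.sum_le_sum fun i _ => ?_
        rw [Equiv.Perm.ofSubtype_apply_coe]
        exact mul_le_mul_of_nonneg_right (rowle i) (hC0 _ _)
    _ ≤ _ := by
        rw [← Finset.mul_sum]
        refine hσ.trans (le_of_eq ?_)
        refine Finset.sum_congr rfl fun i _ => ?_
        rw [← Finset.sum_coe_sort F]
        refine Finset.sum_congr rfl fun j _ => ?_
        rw [ec2]

lemma exists_grid {n : ℕ} {U : Set (EE n)} (hUo : IsOpen U) (R0 : ℝ) (hR0 : 0 ≤ R0)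
    (hU : ∀ x ∈ U, ‖x‖ ≤ R0)
    (s : EE n → EE n) (hs : Measurable s) (hsU : ∀ x ∈ U, ‖s x‖ ≤ R0) (B : Set (EE n))
    (hmp : Measure.map s (volume.restrict U) = volume.restrict B) (η : ℝ) (hη : 0 < η) :
    ∃ T : EE n → EE n, Appr T ∧ Measurable T ∧
      (∀ x ∈ U, ‖s x - T x‖ ≤ R0 + Lc n * (R0 + 2)) ∧ ∫ x in U, ‖s x - T x‖ ≤ 7 * η := by
  classical
  have hUm := hUo.measurableSet
  have hUf : volume U ≠ ⊤ := by
    have : IsBounded U := isBounded_iff_forall_norm_le.2 ⟨R0, hU⟩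
    exact this.measure_lt_top.ne
  have : IsFiniteMeasure (volume.restrict U) := ⟨by simpa using hUf.lt_top⟩
  set μ := (volume.restrict U : Measure (EE n)) with hμ
  set L := Lc n with hL
  have L0 : 0 ≤ L := Lc_nonneg n
  set V := μ.real univ with hV
  have V0 : 0 ≤ V := measureReal_nonneg
  set C0 := R0 + L * (R0 + 2) with hC0
  have C00 : 0 ≤ C0 := by positivity
  have aeU : ∀ {P : EE n → Prop}, (∀ x ∈ U, P x) → ∀ᵐ x ∂μ, P x := fun h =>
    (ae_restrict_iff' hUm).2 (Filter.Eventually.of_forall h)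
  -- approximation by continuous
  have sint : Integrable s μ := Integrable.of_bound hs.aestronglyMeasurable R0 (aeU hsU)
  obtain ⟨g, gcs, gle, gc, gint⟩ := sint.exists_hasCompactSupport_integral_sub_le hη
  have isg : Integrable (fun x => ‖s x - g x‖) μ := (sint.sub gint).norm
  have guc : UniformContinuous g := gcs.uniformContinuous_of_continuous gc
  set ω := η / (V + 1) with hω
  have ω0 : 0 < ω := by positivity
  have ωV : ω * V ≤ η := by
    rw [hω, div_mul_eq_mul_div, div_le_iff₀ (by positivity)]; nlinarith
  obtain ⟨δ1, δ10, hδ1⟩ := Metric.uniformContinuous_iff.1 guc ω ω0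
  -- compact
  obtain ⟨K, hKU, hK, hKv⟩ := hUm.exists_isCompact_sdiff_lt hUf
    (ε := ENNReal.ofReal (η / (C0 + 1))) (by
      have : 0 < η / (C0 + 1) := by positivity
      simpa using this)
  obtain ⟨δ2, δ20, hδ2⟩ := hK.exists_thickening_subset_open hUo hKU
  -- choose h
  obtain ⟨h, hh, h1, hLω, hLδ1, hLδ2⟩ : ∃ h : ℝ, 0 < h ∧ h ≤ 1 ∧ L * h ≤ ω ∧ L * h < δ1 ∧
      L * h < δ2 := by
    set d := min ω (min δ1 δ2) with hd
    have d0 : 0 < d := lt_min ω0 (lt_min δ10 δ20)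
    have dd : L * (d / (L + 1)) < d := by
      rw [mul_div_assoc', div_lt_iff₀ (by positivity)]; nlinarith
    refine ⟨min 1 (d / (L + 1)), lt_min one_pos (by positivity), min_le_left _ _, ?_⟩
    have : L * min 1 (d / (L + 1)) < d :=
      (mul_le_mul_of_nonneg_left (min_le_right _ _) L0).trans_lt dd
    exact ⟨this.le.trans (min_le_left _ _),
      this.trans_le ((min_le_right _ _).trans (min_le_left _ _)),
      this.trans_le ((min_le_right _ _).trans (min_le_right _ _))⟩
  -- finite set of cells
  have Ffin : {c : (Fin n ⊕ Fin n) → ℤ | ∀ j, |h * c j| ≤ R0 + 1}.Finite := by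
    set N := ⌈(R0 + 1) / h⌉ with hN
    refine (Set.Finite.pi' (fun _ : Fin n ⊕ Fin n => Set.finite_Icc (-N) N)).subset ?_
    intro c hc j
    have := hc j
    rw [abs_mul, abs_of_pos hh, mul_comm, ← le_div_iff₀ hh, abs_le] at this
    have hle := Int.le_ceil ((R0 + 1) / h)
    rw [← hN] at hle
    constructor
    · have : (-(N : ℝ)) ≤ c j := by linarith
      exact_mod_cast this
    · have : (c j : ℝ) ≤ N := by linarith
      exact_mod_cast this
  set F := Ffin.toFinset with hF
  have memF : ∀ x : EE n, ‖x‖ ≤ R0 → cell h x ∈ F := by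
    intro x hx
    rw [hF, Set.Finite.mem_toFinset]
    intro j
    have a1 := (cell_iff hh x _).1 rfl j
    have a2 : |x j| ≤ R0 := (PiLp.norm_apply_le x j).trans hx
    rw [abs_le] at a2 ⊢
    constructor <;> linarith
  have bdF : ∀ x : EE n, cell h x ∈ F → ‖x‖ ≤ L * (R0 + 2) := by
    intro x hx
    rw [hF, Set.Finite.mem_toFinset] at hx
    refine norm_le_Lc x _ (by positivity) fun j => ?_
    have a1 := (cell_iff hh x _).1 rfl j
    have a2 := hx j
    rw [abs_le] at a2 ⊢
    constructor <;> linarith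
  set γ : ((Fin n ⊕ Fin n) → ℤ) → EE n := fun c => g (yc h c) with hγ
  set C : ((Fin n ⊕ Fin n) → ℤ) → ((Fin n ⊕ Fin n) → ℤ) → ℝ := fun i j =>
    if (cell h ⁻¹' {i} : Set (EE n)) ⊆ U then ‖γ i - yc h j‖ else 0 with hC
  obtain ⟨σ, hσ, i1, i2⟩ := grid_perm hUm hUf s hs B hmp hh F (fun x hx => memF x (hU x hx))
    (fun x hx => memF _ (hsU x hx)) C
    (fun i j => by simp only [hC]; split_ifs <;> positivity)
    (fun i => by
      by_cases hi : (cell h ⁻¹' {i} : Set (EE n)) ⊆ U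
      · exact Or.inl hi
      · right; intro j; simp [hC, hi])
  set T : EE n → EE n := Tperm h (Equiv.Perm.ofSubtype σ) with hT
  have mT : Measurable T := Tperm_meas h _
  have cT : ∀ x, cell h (T x) = Equiv.Perm.ofSubtype σ (cell h x) := fun x => cell_Tperm hh _ x
  have bdT : ∀ x ∈ U, ‖s x - T x‖ ≤ C0 := by
    intro x hx
    have hm := memF x (hU x hx)
    have : cell h (T x) ∈ F := by
      rw [cT, Equiv.Perm.ofSubtype_apply_of_mem σ hm]
      exact (σ ⟨_, hm⟩).2
    exact (norm_sub_le _ _).trans (add_le_add (hsU x hx) (bdF _ this))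
  refine ⟨T, Appr.perm hh F σ, mT, bdT, ?_⟩
  have mγ : Measurable (fun x : EE n => γ (cell h x)) :=
    (measurable_of_countable γ).comp (cell_meas h)
  obtain ⟨Mg, hMg⟩ := gcs.exists_bound_of_continuous gc
  have iE : Integrable (fun x => ‖s x - γ (cell h x)‖) μ := by
    refine bdd_int hUm hUf _ (hs.sub mγ).norm (R0 + Mg) fun x hx => ?_
    rw [abs_norm]
    exact (norm_sub_le _ _).trans (add_le_add (hsU x hx) (hMg _))
  have Ele : ∫ x, ‖s x - γ (cell h x)‖ ∂μ ≤ 2 * η := by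
    have : ∫ x, ‖s x - γ (cell h x)‖ ∂μ ≤ ∫ x, (‖s x - g x‖ + ω) ∂μ := by
      refine integral_mono iE ((sint.sub gint).norm.add (integrable_const _)) fun x => ?_
      have : ‖g x - γ (cell h x)‖ ≤ ω := by
        rw [← dist_eq_norm]
        refine (hδ1 ?_).le
        rw [dist_eq_norm]
        exact (yc_near hh x).trans_lt hLδ1
      calc ‖s x - γ (cell h x)‖ = ‖(s x - g x) + (g x - γ (cell h x))‖ := by congr 1; abel
        _ ≤ _ := (norm_add_le _ _).trans (by gcongr)
    rw [integral_add isg (integrable_const _), integral_const, smul_eq_mul] at this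
    have : V * ω = ω * V := mul_comm _ _
    linarith
  have Cle : ∫ x, C (cell h x) (cell h (s x)) ∂μ ≤ 3 * η := by
    have : ∫ x, C (cell h x) (cell h (s x)) ∂μ ≤ ∫ x, (‖s x - γ (cell h x)‖ + ω) ∂μ := by
      refine integral_mono i2 (iE.add (integrable_const _)) fun x => ?_
      have a1 := (yc_near hh (s x)).trans hLω
      simp only [hC]
      split_ifs
      · calc ‖γ (cell h x) - yc h (cell h (s x))‖
            = ‖(γ (cell h x) - s x) + (s x - yc h (cell h (s x)))‖ := by congr 1; abel
          _ ≤ _ := (norm_add_le _ _).trans (by rw [norm_sub_rev]; gcongr)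
      · positivity
    rw [integral_add iE (integrable_const _), integral_const, smul_eq_mul] at this
    have : V * ω = ω * V := mul_comm _ _
    linarith
  have mK : MeasurableSet (U \ K) := hUm.diff hK.measurableSet
  have iK : Integrable ((U \ K).indicator (fun _ => C0)) μ := (integrable_const C0).indicator mK
  have Kle : ∫ x, (U \ K).indicator (fun _ => C0) x ∂μ ≤ η := by
    rw [integral_indicator_const _ mK, smul_eq_mul]
    have : μ.real (U \ K) ≤ η / (C0 + 1) := by
      refine ENNReal.toReal_le_of_le_ofReal (by positivity) ?_
      exact (Measure.restrict_apply_le _ _).trans hKv.le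
    calc _ ≤ η / (C0 + 1) * C0 := by gcongr
      _ ≤ η := by rw [div_mul_eq_mul_div, div_le_iff₀ (by positivity)]; nlinarith
  have iL : Integrable (fun x => ‖s x - T x‖) μ := by
    refine bdd_int hUm hUf _ (hs.sub mT).norm C0 fun x hx => ?_
    rw [abs_norm]; exact bdT x hx
  have fin : ∫ x, ‖s x - T x‖ ∂μ ≤ ∫ x, (((‖s x - γ (cell h x)‖ +
      C (cell h x) (Equiv.Perm.ofSubtype σ (cell h x))) + ω) +
      (U \ K).indicator (fun _ => C0) x) ∂μ := by
    refine integral_mono_ae iL (((iE.add i1).add (integrable_const _)).add iK) (aeU fun x hx => ?_)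
    beta_reduce
    have Cn : 0 ≤ C (cell h x) (Equiv.Perm.ofSubtype σ (cell h x)) := by
      simp only [hC]; split_ifs <;> positivity
    by_cases hxK : x ∈ K
    · have good : (cell h ⁻¹' {cell h x} : Set (EE n)) ⊆ U := by
        intro y hy
        refine hδ2 (Metric.mem_thickening_iff.2 ⟨x, hxK, ?_⟩)
        rw [dist_eq_norm]
        exact (cell_near hh y x hy).trans_lt hLδ2
      rw [Set.indicator_of_notMem (fun h => h.2 hxK), add_zero]
      simp only [hC]
      rw [if_pos good, ← cT]
      have a1 := (yc_near hh (T x)).trans hLω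
      rw [norm_sub_rev] at a1
      calc ‖s x - T x‖ = ‖(s x - γ (cell h x)) + (γ (cell h x) - yc h (cell h (T x))) +
            (yc h (cell h (T x)) - T x)‖ := by congr 1; abel
        _ ≤ _ := norm_add₃_le.trans (by gcongr)
    · rw [Set.indicator_of_mem (show x ∈ U \ K from ⟨hx, hxK⟩)]
      have := bdT x hx
      have := norm_nonneg (s x - γ (cell h x))
      linarith
  have j1 : Integrable (fun x => ‖s x - γ (cell h x)‖ +
      C (cell h x) (Equiv.Perm.ofSubtype σ (cell h x))) μ := iE.add i1
  have j2 : Integrable (fun x => ‖s x - γ (cell h x)‖ +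
      C (cell h x) (Equiv.Perm.ofSubtype σ (cell h x)) + ω) μ := j1.add (integrable_const _)
  rw [integral_add j2 iK, integral_add j1 (integrable_const _), integral_add iE i1, integral_const,
    smul_eq_mul] at fin
  have : V * ω = ω * V := mul_comm _ _
  linarith

end Main

theorem stmt_15 (n : ℕ) (hn : 1 ≤ n)
    (U : Set (EuclideanSpace ℝ (Fin n ⊕ Fin n))) (hne : U.Nonempty) (hUo : IsOpen U)
    (hUb : IsBounded U) (hUc : IsConnected U)
    (s : EuclideanSpace ℝ (Fin n ⊕ Fin n) → EuclideanSpace ℝ (Fin n ⊕ Fin n))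
    (hs : Measurable s) (hsb : IsBounded (s '' U))
    (hmp : ∃ B : Set (EuclideanSpace ℝ (Fin n ⊕ Fin n)), MeasurableSet B ∧
      Measure.map s (volume.restrict U) = volume.restrict B)
    (p : ℝ) (hp : 1 ≤ p) (ε : ℝ) (hε : 0 < ε) :
    ∃ S Sinv : EuclideanSpace ℝ (Fin n ⊕ Fin n) → EuclideanSpace ℝ (Fin n ⊕ Fin n),
      ContDiff ℝ (⊤ : ℕ∞) S ∧ ContDiff ℝ (⊤ : ℕ∞) Sinv ∧
      Function.LeftInverse Sinv S ∧ Function.RightInverse Sinv S ∧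
      (∀ x, (matD S x)ᵀ * Matrix.J (Fin n) ℝ * matD S x = Matrix.J (Fin n) ℝ) ∧
      (∫ x in U, ‖s x - S x‖ ^ p) ≤ ε := by
  obtain ⟨B, _, hB⟩ := hmp
  obtain ⟨R1, hR1⟩ := isBounded_iff_forall_norm_le.1 hUb
  obtain ⟨R2, hR2⟩ := isBounded_iff_forall_norm_le.1 hsb
  set R0 := max 0 (max R1 R2) with hR0
  have R00 : 0 ≤ R0 := le_max_left _ _
  have bU : ∀ x ∈ U, ‖x‖ ≤ R0 := fun x hx =>
    (hR1 x hx).trans ((le_max_left _ _).trans (le_max_right _ _))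
  have bs : ∀ x ∈ U, ‖s x‖ ≤ R0 := fun x hx =>
    (hR2 _ (mem_image_of_mem s hx)).trans ((le_max_right _ _).trans (le_max_right _ _))
  have hUm := hUo.measurableSet
  have hUf : volume U ≠ ⊤ := hUb.measure_lt_top.ne
  set C0 := R0 + Lc n * (R0 + 2) with hC0
  have C00 : 0 ≤ C0 := by have := Lc_nonneg n; positivity
  set A := C0 ^ (p - 1) with hA
  have A0 : 0 ≤ A := Real.rpow_nonneg C00 _
  have p0 : 0 ≤ p := by linarith
  obtain ⟨T, aT, mT, bT, iT⟩ := exists_grid hUo R0 R00 bU s hs bs B hB (ε / (14 * (A + 1)))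
    (by positivity)
  obtain ⟨M, M0, hM⟩ := aT
  set C1 := R0 + (R0 + M) with hC1
  have C10 : 0 ≤ C1 := by positivity
  set D := C1 ^ p with hD
  have D0 : 0 ≤ D := Real.rpow_nonneg C10 _
  obtain ⟨S, hS, Sb, Z, mZ, vZ, hZ⟩ := hM R0 (ENNReal.ofReal (ε / (2 * (D + 1))))
    (by have : 0 < ε / (2 * (D + 1)) := by positivity
        simpa using this)
  obtain ⟨Sinv, c1, c2, l, r⟩ := hS.ex
  refine ⟨S, Sinv, c1, c2, l, r, hS.matrix, ?_⟩
  have : IsFiniteMeasure (volume.restrict U) := ⟨by simpa using hUf.lt_top⟩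
  have mS : Measurable S := c1.continuous.measurable
  have bS : ∀ x ∈ U, ‖s x - S x‖ ≤ C1 := by
    intro x hx
    have h1 : ‖S x‖ ≤ R0 + M := by
      calc ‖S x‖ = ‖x + (S x - x)‖ := by congr 1; abel
        _ ≤ _ := (norm_add_le _ _).trans (add_le_add (bU x hx) (Sb x))
    exact (norm_sub_le _ _).trans (add_le_add (bs x hx) h1)
  have iT1 : Integrable (fun x => ‖s x - T x‖) (volume.restrict U) := by
    refine bdd_int hUm hUf _ (hs.sub mT).norm C0 fun x hx => ?_
    rw [abs_norm]; exact bT x hx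
  have iS : Integrable (fun x => ‖s x - S x‖ ^ p) (volume.restrict U) := by
    refine bdd_int hUm hUf _ ((hs.sub mS).norm.pow_const p) D fun x hx => ?_
    rw [abs_of_nonneg (by positivity)]
    exact Real.rpow_le_rpow (norm_nonneg _) (bS x hx) p0
  have iZ : Integrable (Z.indicator (fun _ => D)) (volume.restrict U) :=
    (integrable_const D).indicator mZ
  have key : ∫ x in U, ‖s x - S x‖ ^ p ≤ ∫ x in U, (A * ‖s x - T x‖ + Z.indicator (fun _ => D) x) := by
    refine integral_mono_ae iS ((iT1.const_mul A).add iZ)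
      ((ae_restrict_iff' hUm).2 (Filter.Eventually.of_forall fun x hx => ?_))
    beta_reduce
    by_cases hxZ : x ∈ Z
    · rw [Set.indicator_of_mem hxZ]
      have := Real.rpow_le_rpow (norm_nonneg _) (bS x hx) p0
      have h2 : 0 ≤ A * ‖s x - T x‖ := by positivity
      linarith
    · rw [Set.indicator_of_notMem hxZ, add_zero, hZ x (bU x hx) hxZ]
      have hb := bT x hx
      rcases (norm_nonneg (s x - T x)).eq_or_lt with h0 | h0
      · rw [← h0, Real.zero_rpow (by linarith), mul_zero]
      · have : ‖s x - T x‖ ^ p = ‖s x - T x‖ ^ (p - 1) * ‖s x - T x‖ := by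
          rw [Real.rpow_sub_one h0.ne']; field_simp
        rw [this]
        exact mul_le_mul_of_nonneg_right
          (Real.rpow_le_rpow h0.le hb (by linarith)) h0.le
  rw [integral_add (iT1.const_mul A) iZ, integral_const_mul, integral_indicator_const _ mZ,
    smul_eq_mul] at key
  have v : (volume.restrict U).real Z ≤ ε / (2 * (D + 1)) :=
    ENNReal.toReal_le_of_le_ofReal (by positivity) ((Measure.restrict_apply_le _ _).trans vZ)
  have k1 : (volume.restrict U).real Z * D ≤ ε / 2 := by
    calc _ ≤ ε / (2 * (D + 1)) * D := by gcongr
      _ ≤ ε / 2 := by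
        rw [div_mul_eq_mul_div, div_le_div_iff₀ (by positivity) (by positivity)]; nlinarith
  have k2 : A * ∫ x in U, ‖s x - T x‖ ≤ ε / 2 := by
    calc _ ≤ A * (7 * (ε / (14 * (A + 1)))) := by gcongr
      _ ≤ ε / 2 := by
        have : A * (7 * (ε / (14 * (A + 1)))) = (A * ε) / (2 * (A + 1)) := by field_simp; ring
        rw [this, div_le_div_iff₀ (by positivity) (by positivity)]; nlinarith
  linarith

end
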